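/- arXiv:1804.10043 — 13 statements merged into one kernel-verified Lean document; each statement's English description precedes it below -/
import Mathlib

section
/- Let α > 0 and let μ be a σ-finite Borel measure on (0,∞) satisfying ∫₀^∞ min(x, x²) e^{−αx} μ(dx) < ∞. Define, for t > 0, ν_α(t) = ∫₀^∞ e^{−tz} (∫₀^∞ 2 sin²(x√(z/2)) e^{−αx} μ(dx)) dz / (π√(2z)). Then for every s > 0, ∫₀^∞ (e^{−sx} − 1 + sx) e^{−αx} x^{−1} μ(dx) = ∫₀^∞ (1 − e^{−s²t/2}) ν_α(t) t^{−1} dt. -/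
open MeasureTheory Real

theorem toReal_lintegral_lintegral_eq_integral_integral {X Y : Type*} [MeasurableSpace X]
    [MeasurableSpace Y] {μ : Measure X} {ν : Measure Y} [SFinite ν] {f : X → Y → ℝ}
    (hf : Measurable (Function.uncurry f)) (h0 : ∀ x y, 0 ≤ f x y)
    (hi : ∀ᵐ x ∂μ, Integrable (f x) ν) :
    (∫⁻ x, ∫⁻ y, ENNReal.ofReal (f x y) ∂ν ∂μ).toReal = ∫ x, ∫ y, f x y ∂ν ∂μ := by
  rw [integral_eq_lintegral_of_nonneg_ae
    (Filter.Eventually.of_forall fun x => integral_nonneg (h0 x))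
    hf.stronglyMeasurable.integral_prod_right.aestronglyMeasurable]
  congr 1
  refine lintegral_congr_ae ?_
  filter_upwards [hi] with x hx
  exact (ofReal_integral_eq_lintegral_ofReal hx (Filter.Eventually.of_forall (h0 x))).symm

/-- Tonelli's theorem for Bochner integrals of nonnegative functions whose sections are
integrable: no joint integrability is needed. -/
theorem integral_integral_swap_of_nonneg {X Y : Type*} [MeasurableSpace X]
    [MeasurableSpace Y] {μ : Measure X} {ν : Measure Y} [SFinite μ] [SFinite ν] {f : X → Y → ℝ}
    (hf : Measurable (Function.uncurry f)) (h0 : ∀ x y, 0 ≤ f x y)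
    (hx : ∀ᵐ x ∂μ, Integrable (f x) ν) (hy : ∀ᵐ y ∂ν, Integrable (fun x => f x y) μ) :
    ∫ x, ∫ y, f x y ∂ν ∂μ = ∫ y, ∫ x, f x y ∂μ ∂ν := by
  rw [← toReal_lintegral_lintegral_eq_integral_integral hf h0 hx,
    ← toReal_lintegral_lintegral_eq_integral_integral (f := fun y x => f x y)
      (hf.comp measurable_swap) (fun y x => h0 x y) hy,
    lintegral_lintegral_swap hf.ennreal_ofReal.aemeasurable]

theorem integral_exp_neg_mul_sq_mul_cos_Ioi {b : ℝ} (hb : 0 < b) (c : ℝ) :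
    ∫ u in Set.Ioi (0 : ℝ), Real.exp (-b * u ^ 2) * Real.cos (c * u) =
      √(π / b) / 2 * Real.exp (-c ^ 2 / (4 * b)) := by
  have hb' : 0 < (b : ℂ).re := by simpa using hb
  have hInt : Integrable fun x : ℝ =>
      Complex.exp (Complex.I * c * x) * Complex.exp (-(b : ℂ) * x ^ 2) :=
    .of_integral_ne_zero (by
      rw [fourierIntegral_gaussian hb']
      simp [Complex.cpow_eq_zero_iff, hb.ne', Real.pi_ne_zero])
  have key : ∫ x : ℝ, Real.exp (-b * x ^ 2) * Real.cos (c * x) =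
      √(π / b) * Real.exp (-c ^ 2 / (4 * b)) := by
    have h := integral_re hInt
    rw [fourierIntegral_gaussian hb'] at h
    convert h using 1
    · congr 1; funext x
      rw [show Complex.I * c * x = ((c * x : ℝ) : ℂ) * Complex.I by push_cast; ring,
        show -(b : ℂ) * x ^ 2 = ((-b * x ^ 2 : ℝ) : ℂ) by push_cast; ring,
        ← Complex.ofReal_exp]
      change _ = (Complex.exp (((c * x : ℝ) : ℂ) * Complex.I) *
        ((Real.exp (-b * x ^ 2) : ℝ) : ℂ)).re
      rw [Complex.re_mul_ofReal, Complex.exp_ofReal_mul_I_re, mul_comm]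
    · rw [show (π / b : ℂ) = ((π / b : ℝ) : ℂ) by push_cast; ring,
        show (1 / 2 : ℂ) = ((1 / 2 : ℝ) : ℂ) by push_cast; ring,
        ← Complex.ofReal_cpow (by positivity), ← Real.sqrt_eq_rpow,
        show (-(c : ℂ) ^ 2 / (4 * b)) = ((-c ^ 2 / (4 * b) : ℝ) : ℂ) by push_cast; ring,
        ← Complex.ofReal_exp, ← Complex.ofReal_mul]
      rfl
  have habs := integral_comp_abs (f := fun u : ℝ => Real.exp (-b * u ^ 2) * Real.cos (c * u))
  have heven : ∀ u : ℝ, Real.cos (c * |u|) = Real.cos (c * u) := fun u => by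
    rcases abs_choice u with h | h <;> simp [h]
  simp only [sq_abs, heven] at habs
  linarith

theorem integral_exp_neg_mul_sin_sq_Ioi {t : ℝ} (ht : 0 < t) (x : ℝ) :
    ∫ z in Set.Ioi (0 : ℝ),
        Real.exp (-t * z) * (2 * Real.sin (x * √(z / 2)) ^ 2) / (π * √(2 * z)) =
      (1 - Real.exp (-x ^ 2 / (2 * t))) / √(2 * π * t) := by
  rw [← integral_comp_rpow_Ioi_of_pos (p := 2) (by norm_num)]
  have h1 : IntegrableOn (fun u : ℝ => Real.exp (-t * u ^ 2)) (Set.Ioi 0) :=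
    (integrable_exp_neg_mul_sq ht).integrableOn
  have h2 : IntegrableOn (fun u : ℝ => Real.exp (-t * u ^ 2) * Real.cos ((√2 * x) * u))
      (Set.Ioi 0) :=
    h1.mul_bdd (c := 1) (by fun_prop)
      (Filter.Eventually.of_forall fun u => by simpa using Real.abs_cos_le_one _)
  have : ∀ u ∈ Set.Ioi (0 : ℝ), (2 * u ^ ((2 : ℝ) - 1)) • (Real.exp (-t * u ^ (2 : ℝ)) *
      (2 * Real.sin (x * √(u ^ (2 : ℝ) / 2)) ^ 2) / (π * √(2 * u ^ (2 : ℝ)))) =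
      √2 / π * (Real.exp (-t * u ^ 2) - Real.exp (-t * u ^ 2) * Real.cos ((√2 * x) * u)) := by
    intro u hu
    have hu : 0 < u := hu
    have h2 : √2 * √2 = 2 := Real.mul_self_sqrt (by norm_num)
    have e1 : √(u ^ 2 / 2) = √2 * u / 2 := by
      rw [Real.sqrt_div (by positivity), Real.sqrt_sq hu.le]
      field_simp; nlinarith
    have e2 : (√2 * x) * u = 2 * (x * (√2 * u / 2)) := by ring
    rw [Real.rpow_two, show (2 : ℝ) - 1 = 1 by norm_num, Real.rpow_one, e1, e2, Real.cos_two_mul,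
      Real.sqrt_mul (by norm_num), Real.sqrt_sq hu.le, Real.cos_sq', smul_eq_mul]
    generalize Real.sin (x * (√2 * u / 2)) = S
    field_simp
    linear_combination (-2) * S ^ 2 * h2
  rw [setIntegral_congr_fun measurableSet_Ioi this, integral_const_mul, integral_sub h1 h2,
    integral_gaussian_Ioi, integral_exp_neg_mul_sq_mul_cos_Ioi ht]
  have h2 : √2 * √2 = 2 := Real.mul_self_sqrt (by norm_num)
  have hp : √π * √π = π := Real.mul_self_sqrt pi_pos.le
  have e : -(√2 * x) ^ 2 / (4 * t) = -x ^ 2 / (2 * t) := by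
    field_simp; linear_combination (-2*x^2) * h2
  rw [e, Real.sqrt_div pi_pos.le, Real.sqrt_mul (by positivity), Real.sqrt_mul (by positivity)]
  have : 0 < √π := by positivity
  have : 0 < √t := by positivity
  field_simp
  linear_combination (1 - Real.exp (-(x ^ 2 / (2 * t)))) * ((√π * √π) * h2 + 2 * hp)

/-- The antiderivative of the Gaussian `v ↦ e^{-v²/2}` vanishing at `0`. -/
noncomputable def gaussPrimitive (y : ℝ) : ℝ := ∫ v in (0 : ℝ)..y, Real.exp (-(v ^ 2 / 2))

theorem hasDerivAt_gaussPrimitive (y : ℝ) :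
    HasDerivAt gaussPrimitive (Real.exp (-(y ^ 2 / 2))) y :=
  intervalIntegral.integral_hasDerivAt_right (by apply Continuous.intervalIntegrable; fun_prop)
    (by apply Continuous.stronglyMeasurableAtFilter; fun_prop) (by fun_prop)

theorem tendsto_gaussPrimitive_atTop :
    Filter.Tendsto gaussPrimitive Filter.atTop (nhds (√(2 * π) / 2)) := by
  have h := intervalIntegral_tendsto_integral_Ioi (0 : ℝ)
    (integrable_exp_neg_mul_sq (b := 1 / 2) (by norm_num)).integrableOn Filter.tendsto_id
  rw [integral_gaussian_Ioi] at h
  convert h using 2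
  · simp only [gaussPrimitive, id]
    congr 1; funext v; congr 1; ring
  · congr 2; ring

theorem gaussPrimitive_neg (y : ℝ) : gaussPrimitive (-y) = -gaussPrimitive y := by
  have := intervalIntegral.integral_comp_neg (a := 0) (b := y) fun v : ℝ => Real.exp (-(v ^ 2 / 2))
  simp only [even_two, Even.neg_pow, neg_zero] at this
  rw [gaussPrimitive, gaussPrimitive, this, intervalIntegral.integral_symm]

theorem tendsto_gaussPrimitive_atBot :
    Filter.Tendsto gaussPrimitive Filter.atBot (nhds (-(√(2 * π) / 2))) := by
  have := (tendsto_gaussPrimitive_atTop.comp Filter.tendsto_neg_atBot_atTop).neg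
  simpa [Function.comp_def, gaussPrimitive_neg] using this

/-- An antiderivative of `w ↦ 2 (1 - e^{-s²w²/2}) (1 - e^{-x²/(2w²)}) / w²` on `(0, ∞)`. -/
noncomputable def thorinPrimitive (s x w : ℝ) : ℝ :=
  -(2 * ((1 - Real.exp (-(s ^ 2 * w ^ 2 / 2))) / w)) + 2 * s * gaussPrimitive (s * w)
    - 2 / x * gaussPrimitive (-(x / w))
    + 1 / x * (Real.exp (-(s * x)) * gaussPrimitive (s * w - x / w)
      - Real.exp (s * x) * gaussPrimitive (s * w + x / w))

theorem hasDerivAt_thorinPrimitive (s : ℝ) {x w : ℝ} (hx : x ≠ 0) (hw : w ≠ 0) :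
    HasDerivAt (thorinPrimitive s x)
      (2 * (1 - Real.exp (-(s ^ 2 * w ^ 2 / 2))) * (1 - Real.exp (-(x ^ 2 / (2 * w ^ 2))))
        / w ^ 2) w := by
  have hmul : HasDerivAt (fun w : ℝ => s * w) s w := by
    simpa using (hasDerivAt_id w).const_mul s
  have hdiv : HasDerivAt (fun w : ℝ => x / w) (-(x / w ^ 2)) w := by
    simpa [div_eq_mul_inv] using (hasDerivAt_inv hw).const_mul x
  have hexp : HasDerivAt (fun w : ℝ => 1 - Real.exp (-(s ^ 2 * w ^ 2 / 2)))
      (s ^ 2 * w * Real.exp (-(s ^ 2 * w ^ 2 / 2))) w := by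
    have := (((((hasDerivAt_pow 2 w).const_mul (s ^ 2)).div_const 2).neg).exp).const_sub 1
    refine this.congr_deriv ?_
    simp only [Pi.neg_apply]
    push_cast; ring
  have h1 := (hexp.div (hasDerivAt_id w) hw).const_mul 2
  have h2 := ((hasDerivAt_gaussPrimitive (s * w)).comp w hmul).const_mul (2 * s)
  have h3 := ((hasDerivAt_gaussPrimitive (-(x / w))).comp w hdiv.neg).const_mul (2 / x)
  have h4 := ((hasDerivAt_gaussPrimitive (s * w - x / w)).comp w (hmul.sub hdiv)).const_mul
    (Real.exp (-(s * x)))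
  have h5 := ((hasDerivAt_gaussPrimitive (s * w + x / w)).comp w (hmul.add hdiv)).const_mul
    (Real.exp (s * x))
  refine (((h1.neg.add h2).sub h3).add ((h4.sub h5).const_mul (1 / x))).congr_deriv ?_
  have e4 : Real.exp (-(s * x)) * Real.exp (-((s * w - x / w) ^ 2 / 2)) =
      Real.exp (-(s ^ 2 * w ^ 2 / 2)) * Real.exp (-(x ^ 2 / (2 * w ^ 2))) := by
    rw [← Real.exp_add, ← Real.exp_add]; congr 1; field_simp; ring
  have e5 : Real.exp (s * x) * Real.exp (-((s * w + x / w) ^ 2 / 2)) =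
      Real.exp (-(s ^ 2 * w ^ 2 / 2)) * Real.exp (-(x ^ 2 / (2 * w ^ 2))) := by
    rw [← Real.exp_add, ← Real.exp_add]; congr 1; field_simp; ring
  rw [← mul_assoc (Real.exp (-(s * x))), ← mul_assoc (Real.exp (s * x)), e4, e5,
    show -((s * w) ^ 2 / 2) = -(s ^ 2 * w ^ 2 / 2) by ring,
    show -((-(x / w)) ^ 2 / 2) = -(x ^ 2 / (2 * w ^ 2)) by field_simp]
  simp only [id]
  field_simp
  ring

theorem one_sub_exp_neg_nonneg {y : ℝ} (hy : 0 ≤ y) : 0 ≤ 1 - Real.exp (-y) :=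
  sub_nonneg.2 (Real.exp_le_one_iff.2 (neg_nonpos.2 hy))

theorem one_sub_exp_neg_le (y : ℝ) : 1 - Real.exp (-y) ≤ y := by
  linarith [Real.add_one_le_exp (-y)]

open Filter Topology in
theorem tendsto_thorinPrimitive_atTop {s : ℝ} (hs : 0 < s) (x : ℝ) :
    Tendsto (thorinPrimitive s x) atTop
      (𝓝 (√(2 * π) / 2 * (2 * s + (Real.exp (-(s * x)) - Real.exp (s * x)) / x))) := by
  have hmul : Tendsto (fun w : ℝ => s * w) atTop atTop := tendsto_id.const_mul_atTop hs
  have hdiv : Tendsto (fun w : ℝ => x / w) atTop (𝓝 0) := tendsto_const_nhds.div_atTop tendsto_id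
  have h1 : Tendsto (fun w : ℝ => (1 - Real.exp (-(s ^ 2 * w ^ 2 / 2))) / w) atTop (𝓝 0) := by
    refine squeeze_zero' ?_ ?_ tendsto_inv_atTop_zero
    · filter_upwards [eventually_gt_atTop 0] with w hw
      exact div_nonneg (one_sub_exp_neg_nonneg (by positivity)) hw.le
    · filter_upwards [eventually_gt_atTop 0] with w hw
      rw [inv_eq_one_div]
      gcongr
      linarith [Real.exp_pos (-(s ^ 2 * w ^ 2 / 2))]
  have h3 : Tendsto (fun w : ℝ => gaussPrimitive (-(x / w))) atTop (𝓝 0) := by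
    have := (hasDerivAt_gaussPrimitive 0).continuousAt.tendsto
    rw [show gaussPrimitive 0 = 0 by simp [gaussPrimitive]] at this
    exact this.comp (by simpa using hdiv.neg)
  have h2 := tendsto_gaussPrimitive_atTop.comp hmul
  have h4 := tendsto_gaussPrimitive_atTop.comp (hmul.atTop_add hdiv.neg)
  have h5 := tendsto_gaussPrimitive_atTop.comp (hmul.atTop_add hdiv)
  simp only [← sub_eq_add_neg] at h4
  convert (((h1.const_mul 2).neg.add (h2.const_mul (2 * s))).sub (h3.const_mul (2 / x))).add
    (((h4.const_mul (Real.exp (-(s * x)))).sub (h5.const_mul (Real.exp (s * x)))).const_mul (1 / x))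
    using 2
  · rfl
  · ring

open Filter Topology in
theorem tendsto_thorinPrimitive_nhdsGT_zero (s : ℝ) {x : ℝ} (hx : 0 < x) :
    Tendsto (thorinPrimitive s x) (𝓝[>] 0)
      (𝓝 (√(2 * π) / 2 * ((2 - Real.exp (-(s * x)) - Real.exp (s * x)) / x))) := by
  have hid : Tendsto (fun w : ℝ => w) (𝓝[>] 0) (𝓝 0) := nhdsWithin_le_nhds
  have hmul : Tendsto (fun w : ℝ => s * w) (𝓝[>] 0) (𝓝 0) := by simpa using hid.const_mul s
  have hdiv : Tendsto (fun w : ℝ => x / w) (𝓝[>] 0) atTop := by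
    simpa [div_eq_mul_inv] using tendsto_inv_nhdsGT_zero.const_mul_atTop hx
  have h1 : Tendsto (fun w : ℝ => (1 - Real.exp (-(s ^ 2 * w ^ 2 / 2))) / w) (𝓝[>] 0) (𝓝 0) := by
    refine squeeze_zero' ?_ ?_ (g := fun w => s ^ 2 / 2 * w) (by simpa using hid.const_mul _)
    · filter_upwards [self_mem_nhdsWithin] with w (hw : 0 < w)
      exact div_nonneg (one_sub_exp_neg_nonneg (by positivity)) hw.le
    · filter_upwards [self_mem_nhdsWithin] with w (hw : 0 < w)
      rw [div_le_iff₀ hw]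
      exact (one_sub_exp_neg_le _).trans_eq (by ring)
  have h2 : Tendsto (fun w : ℝ => gaussPrimitive (s * w)) (𝓝[>] 0) (𝓝 0) := by
    have := (hasDerivAt_gaussPrimitive 0).continuousAt.tendsto
    rw [show gaussPrimitive 0 = 0 by simp [gaussPrimitive]] at this
    exact this.comp hmul
  have h3 := tendsto_gaussPrimitive_atBot.comp (tendsto_neg_atTop_atBot.comp hdiv)
  have h4 := tendsto_gaussPrimitive_atBot.comp
    (hmul.add_atBot (tendsto_neg_atTop_atBot.comp hdiv))
  have h5 := tendsto_gaussPrimitive_atTop.comp (hmul.add_atTop hdiv)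
  simp only [Function.comp_def, ← sub_eq_add_neg] at h3 h4 h5
  convert (((h1.const_mul 2).neg.add (h2.const_mul (2 * s))).sub (h3.const_mul (2 / x))).add
    (((h4.const_mul (Real.exp (-(s * x)))).sub (h5.const_mul (Real.exp (s * x)))).const_mul (1 / x))
    using 2
  · rfl
  · ring

theorem thorin_integrand_nonneg (s x t : ℝ) :
    0 ≤ (1 - Real.exp (-s ^ 2 * t / 2)) * ((1 - Real.exp (-x ^ 2 / (2 * t))) / √(2 * π * t)) / t := by
  rcases le_or_gt t 0 with ht | ht
  · rw [Real.sqrt_eq_zero_of_nonpos (mul_nonpos_of_nonneg_of_nonpos (by positivity) ht)]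
    simp
  · have h1 := one_sub_exp_neg_nonneg (y := s ^ 2 * t / 2) (by positivity)
    have h2 := one_sub_exp_neg_nonneg (y := x ^ 2 / (2 * t)) (by positivity)
    rw [show -s ^ 2 * t / 2 = -(s ^ 2 * t / 2) by ring, neg_div]
    positivity

open Filter Topology in
theorem integrableOn_and_integral_thorin_Ioi {s x : ℝ} (hs : 0 < s) (hx : 0 < x) :
    IntegrableOn (fun t : ℝ => (1 - Real.exp (-s ^ 2 * t / 2)) *
      ((1 - Real.exp (-x ^ 2 / (2 * t))) / √(2 * π * t)) / t) (Set.Ioi 0) ∧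
    ∫ t in Set.Ioi (0 : ℝ), (1 - Real.exp (-s ^ 2 * t / 2)) *
      ((1 - Real.exp (-x ^ 2 / (2 * t))) / √(2 * π * t)) / t =
      (Real.exp (-(s * x)) - 1 + s * x) / x := by
  set m : ℝ := √(2 * π) / 2 * ((2 - Real.exp (-(s * x)) - Real.exp (s * x)) / x) with hm
  set g : ℝ → ℝ := Function.update (fun t => thorinPrimitive s x (√t)) 0 m with hg
  have hcont : ContinuousWithinAt g (Set.Ici 0) 0 := by
    rw [hg, continuousWithinAt_update_same, Set.Ici_sdiff_left]
    refine (tendsto_thorinPrimitive_nhdsGT_zero s hx).comp ?_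
    refine tendsto_nhdsWithin_iff.2 ⟨?_, ?_⟩
    · simpa using (Real.continuous_sqrt.tendsto 0).mono_left (nhdsWithin_le_nhds (s := Set.Ioi 0))
    · filter_upwards [self_mem_nhdsWithin] with t ht using Real.sqrt_pos.2 ht
  have hderiv : ∀ t ∈ Set.Ioi (0 : ℝ), HasDerivAt g (√(2 * π) *
      ((1 - Real.exp (-s ^ 2 * t / 2)) *
      ((1 - Real.exp (-x ^ 2 / (2 * t))) / √(2 * π * t)) / t)) t := by
    intro t (ht : 0 < t)
    have hst : 0 < √t := Real.sqrt_pos.2 ht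
    have h := (hasDerivAt_thorinPrimitive s hx.ne' hst.ne').comp t (Real.hasDerivAt_sqrt ht.ne')
    refine (h.congr_of_eventuallyEq ?_).congr_deriv ?_
    · filter_upwards [eventually_ne_nhds ht.ne'] with u hu
      simp [hg, Function.update_of_ne hu]
    · have : 0 < √(2 * π) := by positivity
      rw [Real.sq_sqrt ht.le, Real.sqrt_mul (by positivity) t,
        show -s ^ 2 * t / 2 = -(s ^ 2 * t / 2) by ring, neg_div]
      field_simp
  have hpos : ∀ t ∈ Set.Ioi (0 : ℝ), 0 ≤ √(2 * π) *
      ((1 - Real.exp (-s ^ 2 * t / 2)) *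
      ((1 - Real.exp (-x ^ 2 / (2 * t))) / √(2 * π * t)) / t) := fun t _ =>
    mul_nonneg (Real.sqrt_nonneg _) (thorin_integrand_nonneg s x t)
  have hlim : Tendsto g atTop
      (𝓝 (√(2 * π) / 2 * (2 * s + (Real.exp (-(s * x)) - Real.exp (s * x)) / x))) := by
    refine ((tendsto_thorinPrimitive_atTop hs x).comp Real.tendsto_sqrt_atTop).congr' ?_
    filter_upwards [eventually_ne_atTop 0] with u hu
    simp [hg, Function.update_of_ne hu]
  have hc : √(2 * π) ≠ 0 := by positivity
  constructor
  · have := (integrableOn_Ioi_deriv_of_nonneg hcont hderiv hpos hlim).const_mul (√(2 * π))⁻¹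
    simpa only [IntegrableOn, inv_mul_cancel_left₀ hc] using this
  · have := integral_Ioi_of_hasDerivAt_of_nonneg hcont hderiv hpos hlim
    rw [integral_const_mul, show g 0 = m by simp [hg], hm] at this
    refine mul_left_cancel₀ hc (this.trans ?_)
    field_simp
    ring

theorem integrable_mul_exp_of_le_one_of_le_sq {α : ℝ} {μ : Measure ℝ}
    (hfin : ∫⁻ x in Set.Ioi (0 : ℝ),
        ENNReal.ofReal (min x (x ^ 2) * Real.exp (-α * x)) ∂μ < ⊤)
    {h : ℝ → ℝ} (hm : Measurable h) (h0 : ∀ x, 0 ≤ h x) {C : ℝ} (h1 : ∀ x, h x ≤ C)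
    (h2 : ∀ x, h x ≤ C * x ^ 2) :
    Integrable (fun x => h x * Real.exp (-α * x)) (μ.restrict (Set.Ioi 0)) := by
  have hC : 0 ≤ C := (h0 0).trans (h1 0)
  have hmin : Integrable (fun x => min x (x ^ 2) * Real.exp (-α * x))
      (μ.restrict (Set.Ioi 0)) := by
    refine ⟨by fun_prop, (hasFiniteIntegral_iff_ofReal ?_).2 hfin⟩
    filter_upwards [ae_restrict_mem measurableSet_Ioi] with x (hx : 0 < x)
    positivity
  refine (hmin.const_mul C).mono' (by fun_prop) ?_
  filter_upwards [ae_restrict_mem measurableSet_Ioi] with x (hx : 0 < x)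
  rw [Real.norm_of_nonneg (mul_nonneg (h0 x) (Real.exp_nonneg _)), ← mul_assoc]
  gcongr
  rcases le_total x (x ^ 2) with h | h
  · rw [min_eq_left h]
    exact (h1 x).trans (le_mul_of_one_le_right hC (by nlinarith))
  · rw [min_eq_right h]
    exact h2 x

theorem integral_thorinDensity {α : ℝ} {μ : Measure ℝ} [SFinite μ]
    (hfin : ∫⁻ x in Set.Ioi (0 : ℝ),
        ENNReal.ofReal (min x (x ^ 2) * Real.exp (-α * x)) ∂μ < ⊤) {t : ℝ} (ht : 0 < t) :
    ∫ z in Set.Ioi (0 : ℝ), Real.exp (-t * z) *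
        (∫ x in Set.Ioi (0 : ℝ), 2 * Real.sin (x * √(z / 2)) ^ 2 * Real.exp (-α * x) ∂μ) /
        (π * √(2 * z)) =
      ∫ x in Set.Ioi (0 : ℝ),
        (1 - Real.exp (-x ^ 2 / (2 * t))) / √(2 * π * t) * Real.exp (-α * x) ∂μ := by
  have hInt : ∀ x : ℝ, 0 < x → IntegrableOn (fun z : ℝ =>
      Real.exp (-t * z) * (2 * Real.sin (x * √(z / 2)) ^ 2) / (π * √(2 * z))) (Set.Ioi 0) := by
    intro x hx
    refine .of_integral_ne_zero ?_
    rw [integral_exp_neg_mul_sin_sq_Ioi ht]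
    have : Real.exp (-x ^ 2 / (2 * t)) < 1 := by
      rw [Real.exp_lt_one_iff, neg_div]
      exact neg_neg_of_pos (by positivity)
    exact div_ne_zero (sub_ne_zero.2 this.ne') (by positivity)
  have hswap := integral_integral_swap_of_nonneg (μ := volume.restrict (Set.Ioi (0 : ℝ)))
    (ν := μ.restrict (Set.Ioi 0)) (f := fun z x => Real.exp (-t * z) / (π * √(2 * z)) *
      (2 * Real.sin (x * √(z / 2)) ^ 2 * Real.exp (-α * x)))
    (by simp only [Function.uncurry_def]; fun_prop) (fun z x => by positivity)
    (Filter.Eventually.of_forall fun z => ?_) ?_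
  · calc
      _ = _ := integral_congr_ae (Filter.Eventually.of_forall fun z => ?_)
      _ = _ := hswap
      _ = _ := integral_congr_ae (Filter.Eventually.of_forall fun x => ?_)
    · simp only [integral_const_mul]
      ring
    · simp only [← integral_exp_neg_mul_sin_sq_Ioi ht x, ← integral_mul_const]
      congr 1; funext z; ring
  · refine (integrable_mul_exp_of_le_one_of_le_sq hfin (C := 2 + |z|) (by fun_prop)
      (fun x => by positivity) (fun x => ?_) fun x => ?_).const_mul _
    · linarith [Real.sin_sq_le_one (x * √(z / 2)), abs_nonneg z]
    · have h1 : Real.sin (x * √(z / 2)) ^ 2 ≤ (x * √(z / 2)) ^ 2 :=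
        sq_le_sq.2 Real.abs_sin_le_abs
      have h2 : √(z / 2) ^ 2 ≤ |z| / 2 := by
        rcases le_total 0 z with hz | hz
        · rw [Real.sq_sqrt (by positivity), abs_of_nonneg hz]
        · rw [Real.sqrt_eq_zero_of_nonpos (by linarith)]
          linarith [abs_nonneg z]
      rw [mul_pow] at h1
      nlinarith [sq_nonneg x]
  · filter_upwards [ae_restrict_mem measurableSet_Ioi] with x hx
    refine ((hInt x hx).mul_const (Real.exp (-α * x))).congr
      (Filter.Eventually.of_forall fun z => ?_)
    ring

/-- Polson's rearrangement lemma. Let `α > 0` and let `μ` be a σ-finite Borel measure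
on `(0,∞)` with `∫₀^∞ min(x, x²) e^{−αx} μ(dx) < ∞`. Define, for `t > 0`,
`ν_α(t) = ∫₀^∞ e^{−tz} (∫₀^∞ 2 sin²(x√(z/2)) e^{−αx} μ(dx)) dz/(π√(2z))`.
Then for every `s > 0`,
`∫₀^∞ (e^{−sx} − 1 + sx) e^{−αx} x⁻¹ μ(dx) = ∫₀^∞ (1 − e^{−s²t/2}) ν_α(t) t⁻¹ dt`. -/
theorem levy_to_thorin_rearrangement (α : ℝ) (hα : 0 < α) (μ : Measure ℝ) [SigmaFinite μ]
    (hfin : ∫⁻ x in Set.Ioi (0 : ℝ),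
        ENNReal.ofReal (min x (x ^ 2) * Real.exp (-α * x)) ∂μ < ⊤) :
    ∀ s : ℝ, 0 < s →
      ∫ x in Set.Ioi (0 : ℝ), (Real.exp (-s * x) - 1 + s * x) * Real.exp (-α * x) / x ∂μ =
        ∫ t in Set.Ioi (0 : ℝ),
          (1 - Real.exp (-s ^ 2 * t / 2)) *
            (∫ z in Set.Ioi (0 : ℝ),
              Real.exp (-t * z) *
                (∫ x in Set.Ioi (0 : ℝ),
                  2 * Real.sin (x * Real.sqrt (z / 2)) ^ 2 * Real.exp (-α * x) ∂μ) /
                (Real.pi * Real.sqrt (2 * z))) / t := by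
  intro s hs
  have hswap := integral_integral_swap_of_nonneg (μ := volume.restrict (Set.Ioi (0 : ℝ)))
    (ν := μ.restrict (Set.Ioi 0)) (f := fun t x => (1 - Real.exp (-s ^ 2 * t / 2)) *
      ((1 - Real.exp (-x ^ 2 / (2 * t))) / √(2 * π * t)) / t * Real.exp (-α * x))
    (by simp only [Function.uncurry_def]; fun_prop)
    (fun t x => mul_nonneg (thorin_integrand_nonneg s x t) (Real.exp_nonneg _)) ?_ ?_
  · symm
    calc
      _ = _ := setIntegral_congr_fun measurableSet_Ioi fun t ht => ?_
      _ = _ := hswap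
      _ = _ := setIntegral_congr_fun measurableSet_Ioi fun x hx => ?_
    · rw [integral_thorinDensity hfin ht, ← integral_const_mul, ← integral_div]
      congr 1; funext x; ring
    · rw [integral_mul_const, (integrableOn_and_integral_thorin_Ioi hs hx).2, neg_mul s]
      ring
  · filter_upwards [ae_restrict_mem measurableSet_Ioi] with t (ht : 0 < t)
    refine ((integrable_mul_exp_of_le_one_of_le_sq hfin
      (h := fun x => 1 - Real.exp (-(x ^ 2 / (2 * t))))
      (C := 1 + 1 / (2 * t)) (by fun_prop) (fun x => one_sub_exp_neg_nonneg (by positivity))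
      (fun x => ?_) fun x => ?_).const_mul
        ((1 - Real.exp (-s ^ 2 * t / 2)) / √(2 * π * t) / t)).congr
      (Filter.Eventually.of_forall fun x => ?_)
    · have : 0 < 1 / (2 * t) := by positivity
      linarith [Real.exp_pos (-(x ^ 2 / (2 * t)))]
    · refine (one_sub_exp_neg_le _).trans ?_
      rw [add_mul, one_mul, one_div_mul_eq_div]
      exact le_add_of_nonneg_left (sq_nonneg x)
    · simp only [neg_div]
      ring
  · filter_upwards [ae_restrict_mem measurableSet_Ioi] with x hx
    exact (integrableOn_and_integral_thorin_Ioi hs hx).1.mul_const _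
end

section
/- For all real x > 0 and t > 0, (1 − e^{−x²/(2t)}) / √t = ∫₀^∞ e^{−tz} · 2 sin²(x √(z/2)) / √(πz) dz. -/
open MeasureTheory Real

theorem integrable_exp_neg_mul_sq_mul_cos {b : ℝ} (hb : 0 < b) (c : ℝ) :
    Integrable fun u : ℝ => Real.exp (-b * u ^ 2) * Real.cos (c * u) := by
  refine (integrable_exp_neg_mul_sq hb).mul_bdd (c := 1) (by fun_prop) ?_
  exact Filter.Eventually.of_forall fun u => by simpa using Real.abs_cos_le_one (c * u)

theorem integral_exp_neg_mul_sq_mul_cos {b : ℝ} (hb : 0 < b) (c : ℝ) :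
    ∫ u : ℝ, Real.exp (-b * u ^ 2) * Real.cos (c * u) =
      √(π / b) * Real.exp (-c ^ 2 / (4 * b)) := by
  have hF := fourierIntegral_gaussian (b := (b : ℂ)) (by simpa using hb) (c : ℂ)
  have hint : Integrable fun u : ℝ =>
      Complex.exp (Complex.I * c * u) * Complex.exp (-(b : ℂ) * (u : ℂ) ^ 2) := by
    refine (integrable_cexp_neg_mul_sq (b := (b : ℂ)) (by simpa using hb)).bdd_mul (c := 1)
      (by fun_prop) ?_
    exact Filter.Eventually.of_forall fun u => by simp [Complex.norm_exp]
  have hre : ∀ u : ℝ,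
      (Complex.exp (Complex.I * c * u) * Complex.exp (-(b : ℂ) * (u : ℂ) ^ 2)).re =
        Real.exp (-b * u ^ 2) * Real.cos (c * u) := by
    intro u
    rw [← Complex.exp_add, Complex.exp_re]
    congr 2 <;> simp [pow_two]
  have hrhs : ((π : ℂ) / b) ^ (1 / 2 : ℂ) * Complex.exp (-(c : ℂ) ^ 2 / (4 * b)) =
      ((√(π / b) * Real.exp (-c ^ 2 / (4 * b)) : ℝ) : ℂ) := by
    rw [Real.sqrt_eq_rpow]
    push_cast [Complex.ofReal_cpow (div_pos pi_pos hb).le]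
    rfl
  rw [hrhs] at hF
  simp_rw [← hre]
  have h := integral_re hint
  simp only [RCLike.re_eq_complex_re] at h
  rw [h, hF, Complex.ofReal_re]

theorem integral_Ioi_exp_neg_mul_sq_mul_one_sub_cos {b : ℝ} (hb : 0 < b) (c : ℝ) :
    ∫ u in Set.Ioi (0 : ℝ), Real.exp (-b * u ^ 2) * (1 - Real.cos (c * u)) =
      √(π / b) * (1 - Real.exp (-c ^ 2 / (4 * b))) / 2 := by
  have habs := integral_comp_abs (f := fun u => Real.exp (-b * u ^ 2) * (1 - Real.cos (c * u)))
  have hcos : ∀ u : ℝ, Real.cos (c * |u|) = Real.cos (c * u) := fun u => by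
    rcases abs_choice u with h | h <;> simp [h]
  simp only [sq_abs, hcos, mul_sub, mul_one] at habs ⊢
  rw [integral_sub (integrable_exp_neg_mul_sq hb) (integrable_exp_neg_mul_sq_mul_cos hb c),
    integral_gaussian, integral_exp_neg_mul_sq_mul_cos hb] at habs
  linarith

/-- For all real `x > 0` and `t > 0`,
`(1 − e^{−x²/(2t)})/√t = ∫₀^∞ e^{−tz} · 2 sin²(x√(z/2))/√(πz) dz`. -/
theorem one_sub_exp_div_sqrt_laplace_repr (x t : ℝ) (hx : 0 < x) (ht : 0 < t) :
    (1 - Real.exp (-x ^ 2 / (2 * t))) / Real.sqrt t =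
      ∫ z in Set.Ioi (0 : ℝ),
        Real.exp (-t * z) * (2 * Real.sin (x * Real.sqrt (z / 2)) ^ 2) / Real.sqrt (Real.pi * z) := by
  have hsubst : ∀ u ∈ Set.Ioi (0 : ℝ),
      ((2 : ℝ) * u ^ ((2 : ℝ) - 1)) • (Real.exp (-t * u ^ (2 : ℝ)) *
        (2 * Real.sin (x * √(u ^ (2 : ℝ) / 2)) ^ 2) / √(π * u ^ (2 : ℝ))) =
      2 / √π * (Real.exp (-t * u ^ 2) * (1 - Real.cos (√2 * x * u))) := by
    intro u hu
    have hu : 0 < u := hu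
    have h2 : √2 * x * u = 2 * (x * (u / √2)) := by
      field_simp
      rw [Real.sq_sqrt (by norm_num)]
    have h1 : (2 : ℝ) - 1 = 1 := by norm_num
    rw [h1, rpow_one, rpow_two, Real.sqrt_div (sq_nonneg u), Real.sqrt_mul pi_pos.le,
      Real.sqrt_sq hu.le, h2, Real.cos_two_mul, Real.cos_sq', smul_eq_mul]
    field_simp
    ring
  rw [← integral_comp_rpow_Ioi_of_pos (p := 2) two_pos,
    setIntegral_congr_fun measurableSet_Ioi hsubst, integral_const_mul,
    integral_Ioi_exp_neg_mul_sq_mul_one_sub_cos ht, Real.sqrt_div pi_pos.le, mul_pow,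
    Real.sq_sqrt (by norm_num : (0 : ℝ) ≤ 2)]
  have harg : -(2 * x ^ 2) / (4 * t) = -x ^ 2 / (2 * t) := by
    field_simp
    norm_num
  rw [harg]
  field_simp
end

section
/- For every real s > 0, log Γ(1 + s) = −γ s + ∫₀^∞ (e^{−st} − 1 + st) / (t (e^t − 1)) dt, where γ is the Euler–Mascheroni constant and Γ is the Gamma function. -/
open MeasureTheory Real

open Filter Topology

lemma one_sub_exp_neg_mul_exp_integrable_prod {a s : ℝ} (ha : 0 < a) :
    Integrable (fun p : ℝ × ℝ ↦ (1 - exp (-p.1 * p.2)) * exp (-a * p.2))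
      ((volume.restrict (Set.Ioc 0 s)).prod (volume.restrict (Set.Ioi 0))) := by
  have hg : Integrable (fun p : ℝ × ℝ ↦ (1 : ℝ) * exp (-a * p.2))
      ((volume.restrict (Set.Ioc 0 s)).prod (volume.restrict (Set.Ioi 0))) :=
    Integrable.mul_prod (integrable_const (1 : ℝ))
      (integrableOn_exp_mul_Ioi (neg_lt_zero.mpr ha) 0)
  refine hg.mono (Continuous.aestronglyMeasurable (by fun_prop)) ?_
  rw [Measure.prod_restrict]
  filter_upwards [ae_restrict_mem (measurableSet_Ioc.prod measurableSet_Ioi)] with p hp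
  obtain ⟨⟨hu, -⟩, ht⟩ := hp
  have ht : 0 < p.2 := ht
  have hexp : exp (-p.1 * p.2) ≤ 1 := exp_le_one_iff.mpr (by nlinarith [mul_pos hu ht])
  rw [norm_mul, norm_mul]
  gcongr
  rw [norm_one, Real.norm_eq_abs, abs_le]
  constructor <;> linarith [exp_pos (-p.1 * p.2)]

lemma integral_one_sub_exp_neg_mul {s t : ℝ} (hs : 0 ≤ s) (ht : 0 < t) :
    ∫ u in Set.Ioc 0 s, (1 - exp (-u * t)) = (exp (-s * t) - 1 + s * t) / t := by
  rw [← intervalIntegral.integral_of_le hs]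
  have hderiv (u : ℝ) (_ : u ∈ Set.uIcc 0 s) :
      HasDerivAt (fun u ↦ u + exp (-u * t) / t) (1 - exp (-u * t)) u := by
    have h := (hasDerivAt_id u).add
      ((((hasDerivAt_id u).neg.mul_const t).exp).div_const t)
    refine h.congr_deriv ?_
    simp only [id, Pi.neg_apply]
    field_simp
    ring
  rw [intervalIntegral.integral_eq_sub_of_hasDerivAt hderiv
    (Continuous.intervalIntegrable (by fun_prop) _ _)]
  simp only [neg_zero, zero_mul, exp_zero]
  field_simp
  ring

lemma integral_one_sub_exp_neg_mul_exp {a u : ℝ} (ha : 0 < a) (hu : 0 ≤ u) :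
    ∫ t in Set.Ioi (0 : ℝ), (1 - exp (-u * t)) * exp (-a * t) = 1 / a - 1 / (a + u) := by
  have hau : -(a + u) < 0 := by linarith
  have hsplit (t : ℝ) : (1 - exp (-u * t)) * exp (-a * t) =
      exp (-a * t) - exp (-(a + u) * t) := by
    rw [sub_mul, one_mul, ← exp_add]
    ring_nf
  simp_rw [hsplit]
  rw [integral_sub (integrableOn_exp_mul_Ioi (neg_lt_zero.mpr ha) 0)
    (integrableOn_exp_mul_Ioi hau 0), integral_exp_mul_Ioi (neg_lt_zero.mpr ha),
    integral_exp_mul_Ioi hau]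
  simp only [mul_zero, exp_zero, neg_div_neg_eq]

lemma integral_one_div_sub_one_div_add {a s : ℝ} (ha : 0 < a) (hs : 0 ≤ s) :
    ∫ u in Set.Ioc 0 s, (1 / a - 1 / (a + u)) = s / a - log (1 + s / a) := by
  rw [← intervalIntegral.integral_of_le hs]
  have hpos (u : ℝ) (hu : u ∈ Set.uIcc 0 s) : 0 < a + u := by
    rw [Set.uIcc_of_le hs] at hu
    linarith [hu.1]
  have hderiv (u : ℝ) (hu : u ∈ Set.uIcc 0 s) :
      HasDerivAt (fun u ↦ u / a - log (a + u)) (1 / a - 1 / (a + u)) u :=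
    ((hasDerivAt_id u).div_const a).sub (((hasDerivAt_id u).const_add a).log (hpos u hu).ne')
  rw [intervalIntegral.integral_eq_sub_of_hasDerivAt hderiv
    (ContinuousOn.intervalIntegrable (continuousOn_const.sub
      (continuousOn_const.div (by fun_prop) fun u hu ↦ (hpos u hu).ne')))]
  have hlog : 1 + s / a = (a + s) / a := by field_simp
  rw [hlog, log_div (by positivity) ha.ne']
  simp only [zero_div, add_zero]
  ring

lemma exp_neg_mul_sub_one_add_nonneg (x : ℝ) (t : ℝ) : 0 ≤ exp (-x * t) - 1 + x * t := by
  linarith [add_one_le_exp (-x * t)]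

lemma integrableOn_frullani_compensated {a s : ℝ} (ha : 0 < a) (hs : 0 ≤ s) :
    IntegrableOn (fun t ↦ (exp (-s * t) - 1 + s * t) / t * exp (-a * t)) (Set.Ioi 0) := by
  refine (one_sub_exp_neg_mul_exp_integrable_prod (s := s) ha).integral_prod_right.congr ?_
  filter_upwards [ae_restrict_mem measurableSet_Ioi] with t ht
  rw [integral_mul_const, integral_one_sub_exp_neg_mul hs ht]

lemma integral_frullani_compensated {a s : ℝ} (ha : 0 < a) (hs : 0 ≤ s) :
    ∫ t in Set.Ioi (0 : ℝ), (exp (-s * t) - 1 + s * t) / t * exp (-a * t) =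
      s / a - log (1 + s / a) := by
  calc
    _ = ∫ t in Set.Ioi (0 : ℝ), ∫ u in Set.Ioc 0 s, (1 - exp (-u * t)) * exp (-a * t) := by
      refine setIntegral_congr_fun measurableSet_Ioi fun t ht ↦ ?_
      rw [integral_mul_const, integral_one_sub_exp_neg_mul hs ht]
    _ = ∫ u in Set.Ioc 0 s, ∫ t in Set.Ioi (0 : ℝ), (1 - exp (-u * t)) * exp (-a * t) :=
      (integral_integral_swap (one_sub_exp_neg_mul_exp_integrable_prod ha)).symm
    _ = ∫ u in Set.Ioc 0 s, (1 / a - 1 / (a + u)) :=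
      setIntegral_congr_fun measurableSet_Ioc fun u hu ↦
        integral_one_sub_exp_neg_mul_exp ha hu.1.le
    _ = _ := integral_one_div_sub_one_div_add ha hs

lemma sum_div_sub_log_one_add_div {s : ℝ} (hs : 0 < s) (n : ℕ) :
    ∑ k ∈ Finset.range n, (s / ((k : ℝ) + 1) - log (1 + s / ((k : ℝ) + 1))) =
      s * (harmonic n - log n) + BohrMollerup.logGammaSeq s n + log s := by
  have h : ∑ k ∈ Finset.range n, (s / ((k : ℝ) + 1) - log (1 + s / ((k : ℝ) + 1))) =
      s * harmonic n + log n.factorial - ∑ k ∈ Finset.range n, log (s + (k + 1 : ℕ)) := by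
    induction n with
    | zero => simp
    | succ n ih =>
      have hn : (0 : ℝ) < (n : ℝ) + 1 := by positivity
      have hlog : 1 + s / ((n : ℝ) + 1) = (s + (n + 1)) / (n + 1) := by
        field_simp
        ring
      rw [Finset.sum_range_succ, ih, Finset.sum_range_succ, harmonic_succ, Nat.factorial_succ,
        hlog, log_div (by positivity) hn.ne']
      push_cast
      rw [log_mul hn.ne' (by positivity)]
      ring
  rw [h, BohrMollerup.logGammaSeq, Finset.sum_range_succ']
  push_cast
  rw [add_zero]
  ring

lemma tendsto_sum_div_sub_log_one_add_div {s : ℝ} (hs : 0 < s) :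
    Tendsto (fun n : ℕ ↦
        ∑ k ∈ Finset.range n, (s / ((k : ℝ) + 1) - log (1 + s / ((k : ℝ) + 1)))) atTop
      (𝓝 (s * eulerMascheroniConstant + log (Gamma (1 + s)))) := by
  have hGamma : log (Gamma (1 + s)) = log (Gamma s) + log s := by
    rw [add_comm, Gamma_add_one hs.ne', log_mul hs.ne' (Gamma_pos_of_pos hs).ne', add_comm]
  rw [hGamma, ← add_assoc]
  refine (((tendsto_eulerMascheroniSeq'.const_mul s).add
    (BohrMollerup.tendsto_log_gamma hs)).add_const (log s)).congr' ?_
  filter_upwards [eventually_ne_atTop 0] with n hn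
  rw [sum_div_sub_log_one_add_div hs, eulerMascheroniSeq', if_neg hn]

lemma hasSum_div_sub_log_one_add_div {s : ℝ} (hs : 0 < s) :
    HasSum (fun k : ℕ ↦ s / ((k : ℝ) + 1) - log (1 + s / ((k : ℝ) + 1)))
      (s * eulerMascheroniConstant + log (Gamma (1 + s))) := by
  refine (hasSum_iff_tendsto_nat_of_nonneg (fun k ↦ ?_) _).mpr
    (tendsto_sum_div_sub_log_one_add_div hs)
  have hpos : 0 < 1 + s / ((k : ℝ) + 1) := by positivity
  linarith [log_le_sub_one_of_pos hpos]

lemma tsum_exp_neg_nat_succ_mul {t : ℝ} (ht : 0 < t) :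
    ∑' k : ℕ, exp (-((k : ℝ) + 1) * t) = 1 / (exp t - 1) := by
  have hterm (k : ℕ) : exp (-((k : ℝ) + 1) * t) = exp (-t) ^ k * exp (-t) := by
    rw [← exp_nat_mul, ← exp_add]
    ring_nf
  have hne : exp t - 1 ≠ 0 := (sub_pos.mpr (one_lt_exp_iff.mpr ht)).ne'
  simp_rw [hterm]
  rw [tsum_mul_right, tsum_geometric_of_lt_one (exp_pos _).le (exp_lt_one_iff.mpr (neg_lt_zero.mpr ht)),
    exp_neg]
  have := exp_ne_zero t
  have hne' : 1 - (exp t)⁻¹ ≠ 0 := by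
    rw [show 1 - (exp t)⁻¹ = (exp t - 1) / exp t by field_simp]
    exact div_ne_zero hne this
  field_simp

/-- For every real `s > 0`,
`log Γ(1 + s) = −γ s + ∫₀^∞ (e^{−st} − 1 + st) / (t (e^t − 1)) dt`,
where `γ` is the Euler–Mascheroni constant. -/
theorem log_Gamma_thorin_repr (s : ℝ) (hs : 0 < s) :
    Real.log (Real.Gamma (1 + s)) =
      -Real.eulerMascheroniConstant * s +
        ∫ t in Set.Ioi (0 : ℝ),
          (Real.exp (-s * t) - 1 + s * t) / (t * (Real.exp t - 1)) := by
  have hpos (k : ℕ) : (0 : ℝ) < (k : ℝ) + 1 := by positivity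
  have hsum := hasSum_div_sub_log_one_add_div hs
  have hnorm (k : ℕ) :
      ∫ t in Set.Ioi (0 : ℝ), ‖(exp (-s * t) - 1 + s * t) / t * exp (-((k : ℝ) + 1) * t)‖ =
        s / ((k : ℝ) + 1) - log (1 + s / ((k : ℝ) + 1)) := by
    rw [← integral_frullani_compensated (hpos k) hs.le]
    refine setIntegral_congr_fun measurableSet_Ioi fun t ht ↦ norm_of_nonneg ?_
    exact mul_nonneg (div_nonneg (exp_neg_mul_sub_one_add_nonneg s t) (le_of_lt ht)) (exp_pos _).le
  have hint := hasSum_integral_of_summable_integral_norm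
    (fun k : ℕ ↦ integrableOn_frullani_compensated (hpos k) hs.le)
    (by simpa only [hnorm] using hsum.summable)
  simp only [integral_frullani_compensated (hpos _) hs.le] at hint
  have hseries : ∫ t in Set.Ioi (0 : ℝ),
      ∑' k : ℕ, (exp (-s * t) - 1 + s * t) / t * exp (-((k : ℝ) + 1) * t) =
      ∫ t in Set.Ioi (0 : ℝ), (exp (-s * t) - 1 + s * t) / (t * (exp t - 1)) := by
    refine setIntegral_congr_fun measurableSet_Ioi fun t ht ↦ ?_
    rw [tsum_mul_left, tsum_exp_neg_nat_succ_mul ht, div_mul_div_comm, mul_one]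
  rw [← hseries, hint.unique hsum]
  ring
end

section
/- For every a > 0 and every real s ≥ 0, ∫₀^∞ e^{−s²x/2} · (a³ √(2π))^{−1} x^{−5/2} e^{−1/(2a²x)} dx = (1 + s/a) e^{−s/a}. -/
open MeasureTheory Real

open Filter Topology Set

/-- The fundamental theorem of calculus on `(a, ∞)` for a nonnegative derivative, with a one-sided
limit at `a`. -/
theorem integral_Ioi_of_hasDerivAt_of_nonneg_of_tendsto {g g' : ℝ → ℝ} {a l m : ℝ}
    (h_left : Tendsto g (𝓝[>] a) (𝓝 l)) (hderiv : ∀ x ∈ Ioi a, HasDerivAt g (g' x) x)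
    (hg' : ∀ x ∈ Ioi a, 0 ≤ g' x) (h_top : Tendsto g atTop (𝓝 m)) :
    ∫ x in Ioi a, g' x = m - l := by
  rw [← Ici_sdiff_left] at h_left
  have hderiv' : ∀ x ∈ Ioi a, HasDerivAt (Function.update g a l) (g' x) x := by
    intro x (hx : a < x)
    apply (hderiv x hx).congr_of_eventuallyEq
    filter_upwards [eventually_ne_nhds hx.ne'] with y hy
    exact Function.update_of_ne hy l g
  have h_top' : Tendsto (Function.update g a l) atTop (𝓝 m) := by
    apply h_top.congr'
    filter_upwards [eventually_ne_atTop a] with x hx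
    exact (Function.update_of_ne hx l g).symm
  simpa using integral_Ioi_of_hasDerivAt_of_nonneg
    (continuousWithinAt_update_same.mpr h_left) hderiv' hg' h_top'

/-- The primitive of `exp (-t ^ 2 / 2)` vanishing at `0`. -/
noncomputable def gaussianPrimitive (w : ℝ) : ℝ := ∫ t in (0 : ℝ)..w, exp (-(1 / 2) * t ^ 2)

theorem hasDerivAt_gaussianPrimitive (w : ℝ) :
    HasDerivAt gaussianPrimitive (exp (-(1 / 2) * w ^ 2)) w := by
  have h : Continuous fun t : ℝ => exp (-(1 / 2) * t ^ 2) := by fun_prop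
  exact (h.integral_hasStrictDerivAt 0 w).hasDerivAt

theorem gaussianPrimitive_zero : gaussianPrimitive 0 = 0 := by
  simp [gaussianPrimitive]

theorem gaussianPrimitive_neg (w : ℝ) : gaussianPrimitive (-w) = -gaussianPrimitive w := by
  have h := intervalIntegral.integral_comp_neg (a := 0) (b := w)
    fun t : ℝ => exp (-(1 / 2) * t ^ 2)
  simp only [neg_sq, neg_zero] at h
  rw [gaussianPrimitive, gaussianPrimitive, intervalIntegral.integral_symm, h]

theorem tendsto_gaussianPrimitive_atTop :
    Tendsto gaussianPrimitive atTop (𝓝 (√(2 * π) / 2)) := by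
  have h := intervalIntegral_tendsto_integral_Ioi (0 : ℝ)
    (integrable_exp_neg_mul_sq (b := 1 / 2) (by norm_num)).integrableOn tendsto_id
  rw [integral_gaussian_Ioi, show π / (1 / 2) = 2 * π by ring] at h
  exact h

theorem tendsto_gaussianPrimitive_atBot :
    Tendsto gaussianPrimitive atBot (𝓝 (-(√(2 * π) / 2))) := by
  refine (tendsto_gaussianPrimitive_atTop.comp tendsto_neg_atBot_atTop).neg.congr fun w => ?_
  simp [gaussianPrimitive_neg]

/-- A primitive of `u ^ 2 * exp (-(u ^ 2 + b ^ 2 / u ^ 2) / 2)` on `(0, ∞)`. -/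
noncomputable def sqMulExpPrimitive (b u : ℝ) : ℝ :=
  (1 + b) / 2 * exp (-b) * gaussianPrimitive (u - b / u) +
    (1 - b) / 2 * exp b * gaussianPrimitive (u + b / u) -
      u * exp (-(u ^ 2 + b ^ 2 / u ^ 2) / 2)

theorem hasDerivAt_sqMulExpPrimitive (b : ℝ) {u : ℝ} (hu : u ≠ 0) :
    HasDerivAt (sqMulExpPrimitive b) (u ^ 2 * exp (-(u ^ 2 + b ^ 2 / u ^ 2) / 2)) u := by
  have hdiv : HasDerivAt (fun v : ℝ => b / v) (-b / u ^ 2) u := by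
    simpa [div_eq_mul_inv] using (hasDerivAt_inv hu).const_mul b
  have hsq : HasDerivAt (fun v : ℝ => -(v ^ 2 + (b / v) ^ 2) / 2) (-u + b ^ 2 / u ^ 3) u := by
    refine ((((hasDerivAt_id u).pow 2).add (hdiv.pow 2)).neg.div_const 2).congr_deriv ?_
    simp only [id, Nat.cast_ofNat, Nat.reduceSub, pow_one]
    field_simp
    ring
  have hminus := (hasDerivAt_gaussianPrimitive (u - b / u)).comp u ((hasDerivAt_id u).sub hdiv)
  have hplus := (hasDerivAt_gaussianPrimitive (u + b / u)).comp u ((hasDerivAt_id u).add hdiv)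
  have h := ((hminus.const_mul ((1 + b) / 2 * exp (-b))).add
    (hplus.const_mul ((1 - b) / 2 * exp b))).sub ((hasDerivAt_id u).mul hsq.exp)
  have eminus : exp (-(1 / 2) * (u - b / u) ^ 2) =
      exp b * exp (-(u ^ 2 + b ^ 2 / u ^ 2) / 2) := by
    rw [← exp_add]; congr 1; field_simp; ring
  have eplus : exp (-(1 / 2) * (u + b / u) ^ 2) =
      exp (-b) * exp (-(u ^ 2 + b ^ 2 / u ^ 2) / 2) := by
    rw [← exp_add]; congr 1; field_simp; ring
  have hb : exp (-b) = (exp b)⁻¹ := exp_neg b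
  refine (h.congr_deriv ?_).congr_of_eventuallyEq (Eventually.of_forall fun v => ?_)
  · simp only [id, div_pow]
    rw [eminus, eplus, hb]
    field_simp
    ring
  · simp [sqMulExpPrimitive, div_pow]

theorem tendsto_sqMulExpPrimitive_atTop (b : ℝ) :
    Tendsto (sqMulExpPrimitive b) atTop (𝓝 ((1 + b) / 2 * exp (-b) * (√(2 * π) / 2) +
      (1 - b) / 2 * exp b * (√(2 * π) / 2) - 0)) := by
  have hdiv : Tendsto (fun u : ℝ => b / u) atTop (𝓝 0) := tendsto_const_nhds.div_atTop tendsto_id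
  refine (((tendsto_gaussianPrimitive_atTop.comp ?_).const_mul _).add
    ((tendsto_gaussianPrimitive_atTop.comp ?_).const_mul _)).sub ?_
  · simp only [sub_eq_add_neg]
    exact tendsto_id.atTop_add hdiv.neg
  · exact tendsto_id.atTop_add hdiv
  · refine tendsto_of_tendsto_of_tendsto_of_le_of_le' tendsto_const_nhds
      ((tendsto_const_nhds (x := (2 : ℝ))).div_atTop tendsto_id) ?_ ?_
    · filter_upwards [eventually_gt_atTop 0] with u hu
      positivity
    · filter_upwards [eventually_gt_atTop 0] with u hu
      have hexp : exp (-(u ^ 2 + b ^ 2 / u ^ 2) / 2) ≤ 2 / u ^ 2 := by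
        rw [neg_div, exp_neg, ← inv_div (u ^ 2) 2]
        refine inv_anti₀ (by positivity) ?_
        have h₁ := add_one_le_exp ((u ^ 2 + b ^ 2 / u ^ 2) / 2)
        have h₂ : 0 ≤ b ^ 2 / u ^ 2 := by positivity
        linarith
      calc u * exp (-(u ^ 2 + b ^ 2 / u ^ 2) / 2) ≤ u * (2 / u ^ 2) := by gcongr
        _ = 2 / id u := by simp only [id]; field_simp

theorem tendsto_sqMulExpPrimitive_zero {b : ℝ} (hb : 0 ≤ b) :
    Tendsto (sqMulExpPrimitive b) (𝓝[>] 0) (𝓝 ((1 + b) / 2 * exp (-b) * (-(√(2 * π) / 2)) +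
      (1 - b) / 2 * exp b * (√(2 * π) / 2) - 0)) := by
  have hid : Tendsto (fun u : ℝ => u) (𝓝[>] 0) (𝓝 0) := nhdsWithin_le_nhds
  have htail : Tendsto (fun u : ℝ => u * exp (-(u ^ 2 + b ^ 2 / u ^ 2) / 2)) (𝓝[>] 0) (𝓝 0) := by
    refine tendsto_of_tendsto_of_tendsto_of_le_of_le' tendsto_const_nhds hid ?_ ?_
    · filter_upwards [self_mem_nhdsWithin] with u (hu : 0 < u)
      positivity
    · filter_upwards [self_mem_nhdsWithin] with u (hu : 0 < u)
      refine mul_le_of_le_one_right hu.le (exp_le_one_iff.mpr ?_)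
      have : 0 ≤ (u ^ 2 + b ^ 2 / u ^ 2) / 2 := by positivity
      linarith
  rcases hb.eq_or_lt with rfl | hb
  · have hP : Tendsto gaussianPrimitive (𝓝[>] 0) (𝓝 0) := by
      have h := (hasDerivAt_gaussianPrimitive 0).continuousAt.tendsto
      rw [gaussianPrimitive_zero] at h
      exact h.mono_left nhdsWithin_le_nhds
    convert ((hP.const_mul ((1 + 0) / 2 * exp (-0))).add
      (hP.const_mul ((1 - 0) / 2 * exp 0))).sub htail using 1
    · ext u
      simp [sqMulExpPrimitive]
    · congr 1
      simp
  · have hdiv : Tendsto (fun u : ℝ => b / u) (𝓝[>] 0) atTop :=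
      tendsto_inv_nhdsGT_zero.const_mul_atTop hb
    refine (((tendsto_gaussianPrimitive_atBot.comp ?_).const_mul _).add
      ((tendsto_gaussianPrimitive_atTop.comp ?_).const_mul _)).sub htail
    · simpa [sub_eq_add_neg] using hid.add_atBot (tendsto_neg_atTop_atBot.comp hdiv)
    · exact hid.add_atTop hdiv

theorem integral_sq_mul_exp_neg_sq_add_div_sq {b : ℝ} (hb : 0 ≤ b) :
    ∫ u in Ioi (0 : ℝ), u ^ 2 * exp (-(u ^ 2 + b ^ 2 / u ^ 2) / 2) =
      √(2 * π) / 2 * ((1 + b) * exp (-b)) := by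
  rw [integral_Ioi_of_hasDerivAt_of_nonneg_of_tendsto (tendsto_sqMulExpPrimitive_zero hb)
    (fun u hu => hasDerivAt_sqMulExpPrimitive b (ne_of_gt hu)) (fun u _ => by positivity)
    (tendsto_sqMulExpPrimitive_atTop b)]
  ring

/-- For every `a > 0` and every real `s ≥ 0`,
`∫₀^∞ e^{−s²x/2} (a³√(2π))⁻¹ x^{−5/2} e^{−1/(2a²x)} dx = (1 + s/a) e^{−s/a}`. -/
theorem reciprocal_gamma_laplace_transform (a : ℝ) (ha : 0 < a) (s : ℝ) (hs : 0 ≤ s) :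
    ∫ x in Set.Ioi (0 : ℝ),
        Real.exp (-s ^ 2 * x / 2) * (a ^ 3 * Real.sqrt (2 * Real.pi))⁻¹ *
          x ^ (-(5 : ℝ) / 2) * Real.exp (-1 / (2 * a ^ 2 * x)) =
      (1 + s / a) * Real.exp (-s / a) := by
  have hsubst : ∀ u ∈ Ioi (0 : ℝ),
      (|(-2 : ℝ)| * u ^ ((-2 : ℝ) - 1)) •
        (exp (-s ^ 2 * u ^ (-2 : ℝ) / 2) * (a ^ 3 * √(2 * π))⁻¹ *
          (u ^ (-2 : ℝ)) ^ (-(5 : ℝ) / 2) * exp (-1 / (2 * a ^ 2 * u ^ (-2 : ℝ)))) =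
      2 / (a * √(2 * π)) *
        ((a⁻¹ * u) ^ 2 * exp (-((a⁻¹ * u) ^ 2 + (s / a) ^ 2 / (a⁻¹ * u) ^ 2) / 2)) := by
    intro u (hu : 0 < u)
    have h₂ : u ^ (-2 : ℝ) = (u ^ 2)⁻¹ := by rw [rpow_neg hu.le, rpow_two]
    have h₃ : u ^ ((-2 : ℝ) - 1) = (u ^ 3)⁻¹ := by
      rw [show (-2 : ℝ) - 1 = -(3 : ℕ) by norm_num, rpow_neg hu.le, rpow_natCast]
    have h₅ : (u ^ (-2 : ℝ)) ^ (-(5 : ℝ) / 2) = u ^ 5 := by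
      rw [← rpow_mul hu.le, show (-2 : ℝ) * (-5 / 2) = (5 : ℕ) by norm_num, rpow_natCast]
    have hexp : exp (-((a⁻¹ * u) ^ 2 + (s / a) ^ 2 / (a⁻¹ * u) ^ 2) / 2) =
        exp (-s ^ 2 * (u ^ 2)⁻¹ / 2) * exp (-1 / (2 * a ^ 2 * (u ^ 2)⁻¹)) := by
      rw [← exp_add]; congr 1; field_simp; ring
    rw [h₅, h₃, h₂, hexp, smul_eq_mul, abs_neg, abs_two]
    field_simp
  rw [← integral_comp_rpow_Ioi _ (p := -2) (by norm_num),
    setIntegral_congr_fun measurableSet_Ioi hsubst, integral_const_mul,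
    integral_comp_mul_left_Ioi
      (fun u => u ^ 2 * exp (-(u ^ 2 + (s / a) ^ 2 / u ^ 2) / 2)) 0 (inv_pos.mpr ha),
    mul_zero, integral_sq_mul_exp_neg_sq_add_div_sq (div_nonneg hs ha.le), neg_div, inv_inv,
    smul_eq_mul]
  field_simp
end

section
/- For every real s, ∫_{−∞}^∞ e^{isx} · (2/√π) e^{x − e^{2x}} dx = Γ((1 + is)/2) / √π, where Γ denotes the complex Gamma function. -/
open MeasureTheory Real Complex

theorem Set.range_exp_two_mul : Set.range (fun x : ℝ => Real.exp (2 * x)) = Set.Ioi 0 := by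
  have h : Function.Surjective (fun x : ℝ => 2 * x) := fun y => ⟨y / 2, by ring⟩
  rw [← Real.range_exp, ← h.range_comp Real.exp]
  rfl

/-- Euler's integral for `Γ` after the substitution `u = e^{2x}`. -/
theorem Complex.Gamma_eq_integral_exp_two_mul {z : ℂ} (hz : 0 < z.re) :
    Complex.Gamma z =
      ∫ x : ℝ, 2 * (Complex.exp (2 * z * x) * (Real.exp (-Real.exp (2 * x)) : ℂ)) := by
  have hderiv : ∀ x ∈ (Set.univ : Set ℝ), HasDerivWithinAt (fun x : ℝ => Real.exp (2 * x))
      (Real.exp (2 * x) * 2) Set.univ x := fun x _ => by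
    simpa using ((hasDerivAt_id x).const_mul 2).exp
  have hinj : Set.InjOn (fun x : ℝ => Real.exp (2 * x)) Set.univ := fun x _ y _ h => by
    simpa using h
  have key := integral_image_eq_integral_abs_deriv_smul MeasurableSet.univ hderiv hinj
    (fun u : ℝ => (Real.exp (-u) : ℂ) * (u : ℂ) ^ (z - 1))
  rw [Set.image_univ, Set.range_exp_two_mul, setIntegral_univ] at key
  rw [Complex.Gamma_eq_integral hz, Complex.GammaIntegral, key]
  refine integral_congr_ae (.of_forall fun x => ?_)
  have hpow : ((Real.exp (2 * x) : ℝ) : ℂ) ^ (z - 1) = Complex.exp (2 * x * (z - 1)) := by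
    rw [Complex.cpow_def_of_ne_zero (by exact_mod_cast (Real.exp_pos _).ne'),
      ← Complex.ofReal_log (Real.exp_pos _).le, Real.log_exp]
    push_cast
    rfl
  have hadd : Complex.exp (2 * z * x) = Complex.exp (2 * x) * Complex.exp (2 * x * (z - 1)) := by
    rw [← Complex.exp_add]
    ring_nf
  dsimp only
  rw [hpow, hadd, abs_of_pos (by positivity), Complex.real_smul]
  push_cast
  ring

/-- The Fourier transform of Hinds' density `(2/√π) e^{x − e^{2x}}` is
`Γ((1 + is)/2)/√π`, where `Γ` is the complex Gamma function. -/
theorem hinds_density_fourier_transform (s : ℝ) :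
    ∫ x : ℝ, Complex.exp (Complex.I * s * x) *
        ((2 / Real.sqrt Real.pi) * Real.exp (x - Real.exp (2 * x)) : ℝ) =
      Complex.Gamma ((1 + Complex.I * s) / 2) / (Real.sqrt Real.pi : ℂ) := by
  have hre : 0 < ((1 + Complex.I * s) / 2).re := by simp
  rw [Complex.Gamma_eq_integral_exp_two_mul hre, ← integral_div]
  refine integral_congr_ae (.of_forall fun x => ?_)
  have hadd : Complex.exp (2 * ((1 + Complex.I * s) / 2) * x) =
      Complex.exp (Complex.I * s * x) * Complex.exp x := by
    rw [← Complex.exp_add]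
    ring_nf
  dsimp only
  rw [hadd, sub_eq_add_neg, Real.exp_add]
  push_cast
  ring
end

section
/- For every real s > 0, π / sinh(πs) = s · ∑_{m ∈ ℤ} (−1)^m / (s² + m²), where the sum over all integers m converges absolutely. -/
open Real

/-- The Mittag-Leffler expansion of `coth` as a sum over the positive integers. -/
lemma hasSum_nat_inv_sq_add_sq {t : ℝ} (ht : 0 < t) :
    HasSum (fun n : ℕ => 1 / (t ^ 2 + ((n : ℝ) + 1) ^ 2))
      ((π * (cosh (π * t) / sinh (π * t)) - 1 / t) / (2 * t)) := by
  have hz : (t * Complex.I : ℂ) ∈ Complex.integerComplement := by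
    rintro ⟨n, hn⟩
    have := congrArg Complex.im hn
    simp at this
    exact ht.ne this
  have hsum := (summable_cotTerm hz).hasSum
  have htsum : ∑' n, cotTerm (t * Complex.I) n = _ := (cot_series_rep' hz).symm
  rw [htsum] at hsum
  have ht0 : (t : ℂ) ≠ 0 := by exact_mod_cast ht.ne'
  have hsinh : Complex.sinh (π * t) ≠ 0 := by
    exact_mod_cast (sinh_pos_iff.mpr (mul_pos pi_pos ht)).ne'
  rw [← Complex.hasSum_ofReal]
  convert! hsum.mul_left (Complex.I / (2 * t)) using 1
  · funext n
    have hne : (t : ℂ) ^ 2 + ((n : ℂ) + 1) ^ 2 ≠ 0 := by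
      exact_mod_cast (by positivity : t ^ 2 + ((n : ℝ) + 1) ^ 2 ≠ 0)
    have hprod : ((t : ℂ) * Complex.I + (n + 1)) * (t * Complex.I - (n + 1)) =
        -((t : ℂ) ^ 2 + ((n : ℂ) + 1) ^ 2) := by
      linear_combination (t : ℂ) ^ 2 * Complex.I_sq
    rw [cotTerm_identity hz, hprod]
    push_cast
    field_simp
    simp
  · rw [Complex.cot, ← mul_assoc (π : ℂ), Complex.cos_mul_I, Complex.sin_mul_I]
    push_cast
    field_simp

/-- The Mittag-Leffler expansion of `coth` as a sum over the integers. -/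
lemma hasSum_int_inv_sq_add_sq {t : ℝ} (ht : 0 < t) :
    HasSum (fun m : ℤ => 1 / (t ^ 2 + (m : ℝ) ^ 2))
      (π * (cosh (π * t) / sinh (π * t)) / t) := by
  have hpos := hasSum_nat_inv_sq_add_sq ht
  have hnat := (hasSum_nat_add_iff (f := fun n : ℕ => 1 / (t ^ 2 + (n : ℝ) ^ 2)) 1).mp
    (by simpa using hpos)
  have hint := HasSum.of_nat_of_neg (f := fun m : ℤ => 1 / (t ^ 2 + (m : ℝ) ^ 2))
    (by simpa using hnat) (by simpa using hnat)
  convert! hint using 1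
  have := (sinh_pos_iff.mpr (mul_pos pi_pos ht)).ne'
  simp
  field_simp
  ring

lemma hasSum_int_inv_sq_add_sq_of_even {s : ℝ} (hs : 0 < s) :
    HasSum (fun m : ℤ => if Even m then 1 / (s ^ 2 + (m : ℝ) ^ 2) else 0)
      (π * (cosh (π * (s / 2)) / sinh (π * (s / 2))) / (2 * s)) := by
  have hinj : Function.Injective (fun m : ℤ => 2 * m) := fun a b h => by simpa using h
  rw [← hinj.hasSum_iff]
  · convert! (hasSum_int_inv_sq_add_sq (half_pos hs)).mul_left (1 / 4) using 1
    · funext m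
      simp only [Function.comp_apply, even_two_mul, if_true, Int.cast_mul, Int.cast_ofNat]
      have : s ^ 2 + (2 * (m : ℝ)) ^ 2 ≠ 0 := by positivity
      have : (s / 2) ^ 2 + (m : ℝ) ^ 2 ≠ 0 := by positivity
      field_simp
      ring
    · field_simp
      norm_num
  · intro m hm
    refine if_neg fun h => hm ?_
    obtain ⟨k, rfl⟩ := h
    exact ⟨k, by ring⟩

/-- The partial fraction expansion of `1 / sinh`. -/
lemma hasSum_int_neg_one_zpow_div_sq_add_sq {s : ℝ} (hs : 0 < s) :
    HasSum (fun m : ℤ => (-1 : ℝ) ^ m / (s ^ 2 + (m : ℝ) ^ 2))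
      (π / sinh (π * s) / s) := by
  convert! ((hasSum_int_inv_sq_add_sq_of_even hs).mul_left 2).sub
    (hasSum_int_inv_sq_add_sq hs) using 1
  · funext m
    rcases Int.even_or_odd m with h | h
    · simp only [h.neg_one_zpow, h, if_true]
      ring
    · simp only [h.neg_one_zpow, Int.not_even_iff_odd.mpr h, if_false]
      ring
  · have hsinh := (sinh_pos_iff.mpr (mul_pos pi_pos (half_pos hs))).ne'
    have hcosh := (cosh_pos (π * (s / 2))).ne'
    rw [show π * s = 2 * (π * (s / 2)) by ring, sinh_two_mul, cosh_two_mul]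
    generalize π * (s / 2) = u at *
    field_simp
    linear_combination -cosh_sq u

/-- For every real `s > 0`, `π / sinh(πs) = s ∑_{m ∈ ℤ} (−1)^m / (s² + m²)`,
the sum over all integers converging absolutely. -/
theorem pi_div_sinh_eq_sum (s : ℝ) (hs : 0 < s) :
    Summable (fun m : ℤ => |(-1 : ℝ) ^ m / (s ^ 2 + (m : ℝ) ^ 2)|) ∧
      Real.pi / Real.sinh (Real.pi * s) =
        s * ∑' m : ℤ, (-1 : ℝ) ^ m / (s ^ 2 + (m : ℝ) ^ 2) := by
  have hsum := hasSum_int_neg_one_zpow_div_sq_add_sq hs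
  exact ⟨hsum.summable.abs, by rw [hsum.tsum_eq, mul_div_cancel₀ _ hs.ne']⟩
end

section
/- For all real a > 0 and s > 0, log( as / sinh(as) ) = ∫₀^∞ (e^{−s²t} − 1) · (∑_{n=1}^∞ e^{−π² n² t / a²}) · t^{−1} dt. -/
open MeasureTheory Real

open Filter Topology in
/-- Euler's product for the hyperbolic sine. -/
theorem tendsto_euler_sinh_prod (x : ℝ) :
    Tendsto (fun n : ℕ => x * ∏ j ∈ Finset.range n, (1 + x ^ 2 / (π ^ 2 * ((j : ℝ) + 1) ^ 2)))
      atTop (𝓝 (sinh x)) := by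
  have hpi : (π : ℂ) ≠ 0 := Complex.ofReal_ne_zero.2 pi_ne_zero
  have h := (Complex.continuous_im.tendsto _).comp
    (Complex.tendsto_euler_sin_prod (x / π * Complex.I))
  have hlim : (Complex.sin (π * (x / π * Complex.I))).im = sinh x := by
    rw [← mul_assoc, mul_div_cancel₀ _ hpi, Complex.sin_mul_I]
    simp [← Complex.ofReal_sinh]
  rw [hlim] at h
  refine h.congr fun n => ?_
  have hprod : ∏ j ∈ Finset.range n, ((1 : ℂ) - (x / π * Complex.I) ^ 2 / ((j : ℂ) + 1) ^ 2) =
      ((∏ j ∈ Finset.range n, (1 + x ^ 2 / (π ^ 2 * ((j : ℝ) + 1) ^ 2)) : ℝ) : ℂ) := by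
    push_cast
    refine Finset.prod_congr rfl fun j _ => ?_
    rw [mul_pow, Complex.I_sq, div_pow, mul_neg_one, neg_div, sub_neg_eq_add, div_div]
  simp only [Function.comp_apply]
  rw [hprod, ← mul_assoc, mul_div_cancel₀ _ hpi, mul_assoc, mul_comm Complex.I, ← mul_assoc,
    ← Complex.ofReal_mul, Complex.im_ofReal_mul, Complex.I_im, mul_one]

open Filter Topology in
theorem hasSum_log_sinh_ratio {x : ℝ} (hx : 0 < x) :
    HasSum (fun n : ℕ => log (1 + x ^ 2 / (π ^ 2 * ((n : ℝ) + 1) ^ 2))) (log (sinh x / x)) := by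
  have hnonneg (n : ℕ) : 0 ≤ x ^ 2 / (π ^ 2 * ((n : ℝ) + 1) ^ 2) := by positivity
  rw [hasSum_iff_tendsto_nat_of_nonneg fun n => log_nonneg (by linarith [hnonneg n])]
  have hne : sinh x / x ≠ 0 := (div_pos (sinh_pos_iff.2 hx) hx).ne'
  refine (((tendsto_euler_sinh_prod x).div_const x).log hne).congr fun n => ?_
  rw [mul_div_cancel_left₀ _ hx.ne', log_prod fun j _ => by linarith [hnonneg j]]

theorem integrableOn_exp_sub_one_mul_exp_div {z w : ℝ} (hz : 0 < z) (hw : 0 ≤ w) :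
    IntegrableOn (fun t => (exp (-w * t) - 1) * exp (-z * t) / t) (Set.Ioi 0) := by
  refine ((integrableOn_exp_mul_Ioi (neg_lt_zero.2 hz) 0).const_mul w).mono'
    (Measurable.aestronglyMeasurable (by fun_prop)) ?_
  filter_upwards [ae_restrict_mem measurableSet_Ioi] with t ht
  have ht : 0 < t := ht
  have hle : exp (-w * t) ≤ 1 := exp_le_one_iff.2 (by nlinarith)
  rw [norm_div, norm_mul, norm_of_nonpos (by linarith), norm_of_nonneg (exp_pos _).le,
    norm_of_nonneg ht.le, div_le_iff₀ ht]
  nlinarith [add_one_le_exp (-w * t), exp_pos (-z * t)]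

open Filter Topology in
/-- Frullani's integral for the exponential function. -/
theorem integral_exp_sub_one_mul_exp_div {z w : ℝ} (hz : 0 < z) (hw : 0 ≤ w) :
    ∫ t in Set.Ioi (0 : ℝ), (exp (-w * t) - 1) * exp (-z * t) / t = -log (1 + w / z) := by
  have heq (t : ℝ) : t⁻¹ • (exp (-((z + w) * t)) - exp (-(z * t))) =
      (exp (-w * t) - 1) * exp (-z * t) / t := by
    rw [show -((z + w) * t) = -w * t + -z * t by ring, exp_add, ← neg_mul, smul_eq_mul]
    ring
  have hcont : Continuous fun x : ℝ => exp (-x) := by fun_prop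
  have h := Frullani.integral_Ioi_eq (f := fun x : ℝ => exp (-x)) (a := z + w) (b := z)
    (L := 1) (R := 0) (hcont.locallyIntegrable.locallyIntegrableOn _) (by positivity) hz
    (by simpa using (hcont.tendsto 0).mono_left nhdsWithin_le_nhds)
    tendsto_exp_neg_atTop_nhds_zero
    (by simpa only [heq] using integrableOn_exp_sub_one_mul_exp_div hz hw)
  simp only [heq] at h
  rw [h, sub_zero, smul_eq_mul, mul_one, ← log_inv, inv_eq_one_div]
  congr 1
  field_simp

/-- For all real `a > 0` and `s > 0`,
`log(as/sinh(as)) = ∫₀^∞ (e^{−s²t} − 1) (∑_{n=1}^∞ e^{−π²n²t/a²}) t⁻¹ dt`. -/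
theorem log_sinh_ratio_thorin_repr (a s : ℝ) (ha : 0 < a) (hs : 0 < s) :
    Real.log (a * s / Real.sinh (a * s)) =
      ∫ t in Set.Ioi (0 : ℝ),
        (Real.exp (-s ^ 2 * t) - 1) *
          (∑' n : ℕ, Real.exp (-Real.pi ^ 2 * ((n : ℝ) + 1) ^ 2 * t / a ^ 2)) / t := by
  let c : ℕ → ℝ := fun n => π ^ 2 * ((n : ℝ) + 1) ^ 2 / a ^ 2
  let F : ℕ → ℝ → ℝ := fun n t => (exp (-s ^ 2 * t) - 1) * exp (-c n * t) / t
  have hc (n : ℕ) : 0 < c n := by positivity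
  have hF_int (n : ℕ) : IntegrableOn (F n) (Set.Ioi 0) :=
    integrableOn_exp_sub_one_mul_exp_div (hc n) (sq_nonneg s)
  have hF_integral (n : ℕ) : ∫ t in Set.Ioi (0 : ℝ), F n t =
      -log (1 + (a * s) ^ 2 / (π ^ 2 * ((n : ℝ) + 1) ^ 2)) := by
    rw [integral_exp_sub_one_mul_exp_div (hc n) (sq_nonneg s), div_div_eq_mul_div]
    ring_nf
  have hF_norm (n : ℕ) : ∫ t in Set.Ioi (0 : ℝ), ‖F n t‖ =
      log (1 + (a * s) ^ 2 / (π ^ 2 * ((n : ℝ) + 1) ^ 2)) := by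
    rw [← neg_eq_iff_eq_neg.2 (hF_integral n), ← integral_neg]
    refine setIntegral_congr_fun measurableSet_Ioi fun t (ht : 0 < t) => norm_of_nonpos ?_
    have hle : exp (-s ^ 2 * t) ≤ 1 := exp_le_one_iff.2 (by nlinarith [sq_nonneg s])
    exact div_nonpos_of_nonpos_of_nonneg
      (mul_nonpos_of_nonpos_of_nonneg (by linarith) (exp_pos _).le) ht.le
  have hlog := hasSum_log_sinh_ratio (mul_pos ha hs)
  have hsum := hasSum_integral_of_summable_integral_norm hF_int
    (by simpa only [hF_norm] using hlog.summable)
  simp only [hF_integral] at hsum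
  rw [← inv_div, log_inv, hlog.neg.unique hsum]
  congr 1 with t
  simp only [F, tsum_div_const, tsum_mul_left]
  congr! 5 with n
  simp only [c]
  ring
end

section
/- For every real s > 0, ∫₀^∞ e^{−sx} · (2/√3) ∑_{n=0}^∞ cos(π(2n+1)/6) e^{−π(2n+1)² x / 12} dx = √(π/s) · sinh(2√(πs/3)) / cosh(√(3πs)). -/
open MeasureTheory Real

/-- The series `∑ 1 / (b + c n²)` over the integers converges. -/
lemma summable_inv_add_mul_int_sq {b c : ℝ} (hb : 0 < b) (hc : 0 < c) :
    Summable fun n : ℤ => (b + c * (n : ℝ) ^ 2)⁻¹ := by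
  refine Summable.of_norm_bounded_eventually
    ((Real.summable_one_div_int_pow.mpr one_lt_two).mul_left c⁻¹) ?_
  rw [Filter.eventually_cofinite]
  refine (Set.finite_singleton (0 : ℤ)).subset fun n hn => ?_
  by_contra h0
  have hn0 : 0 < (n : ℝ) ^ 2 := by
    have : (n : ℝ) ≠ 0 := by simpa using h0
    positivity
  refine hn ?_
  rw [Real.norm_of_nonneg (by positivity), one_div, ← mul_inv]
  gcongr
  linarith

/-- The Fourier coefficients on `[0, 1]` of `x ↦ cosh (a (x - 1/2))`. -/
lemma fourierCoeffOn_cosh {a : ℝ} (ha : 0 < a) (n : ℤ) :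
    fourierCoeffOn zero_lt_one (fun x : ℝ => (Real.cosh (a * (x - 1 / 2)) : ℂ)) n =
      ((2 * a * Real.sinh (a / 2) * (a ^ 2 + 4 * π ^ 2 * (n : ℝ) ^ 2)⁻¹ : ℝ) : ℂ) := by
  set w : ℂ := 2 * π * Complex.I * n with hw
  have hexp : Complex.exp w = 1 := by
    rw [hw, show (2 * π * Complex.I * n : ℂ) = n * (2 * π * Complex.I) by ring]
    exact Complex.exp_int_mul_two_pi_mul_I n
  have hp : (a : ℂ) - w ≠ 0 := fun h => ha.ne' (by simpa [hw] using congrArg Complex.re h)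
  have hm : -(a : ℂ) - w ≠ 0 := fun h => ha.ne' (by simpa [hw] using congrArg Complex.re h)
  have hint (c : ℂ) : IntervalIntegrable (fun x : ℝ => Complex.exp (c * x)) volume 0 1 :=
    Continuous.intervalIntegrable (by fun_prop) _ _
  have hsq : (a : ℂ) ^ 2 + 4 * π ^ 2 * n ^ 2 = -((a - w) * (-a - w)) := by
    rw [hw]; ring_nf; rw [Complex.I_sq]; ring
  have hend (c : ℂ) : Complex.exp (c - w) = Complex.exp c := by
    rw [Complex.exp_sub, hexp, div_one]
  rw [fourierCoeffOn_eq_integral]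
  have hfun : ∀ x : ℝ, fourier (-n) (x : AddCircle ((1 : ℝ) - 0)) •
      (Real.cosh (a * (x - 1 / 2)) : ℂ) =
        Complex.exp (-a / 2) / 2 * Complex.exp ((a - w) * x) +
          Complex.exp (a / 2) / 2 * Complex.exp ((-a - w) * x) := fun x => by
    rw [fourier_coe_apply, Complex.ofReal_cosh, Complex.cosh, smul_eq_mul, div_mul_eq_mul_div,
      div_mul_eq_mul_div, ← Complex.exp_add, ← Complex.exp_add, ← add_div, ← mul_div_assoc,
      mul_add, ← Complex.exp_add, ← Complex.exp_add, hw]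
    congr 3 <;> push_cast <;> ring
  simp_rw [hfun]
  rw [intervalIntegral.integral_add ((hint _).const_mul _) ((hint _).const_mul _),
    intervalIntegral.integral_const_mul, intervalIntegral.integral_const_mul,
    integral_exp_mul_complex hp, integral_exp_mul_complex hm]
  push_cast
  rw [hsq, Complex.sinh]
  simp only [mul_one, mul_zero, Complex.exp_zero, hend, sub_zero, div_one, one_smul]
  have e1 : Complex.exp a = Complex.exp (a / 2) * Complex.exp (a / 2) := by
    rw [← Complex.exp_add, add_halves]
  have e2 : Complex.exp (-a / 2) = (Complex.exp (a / 2))⁻¹ := by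
    rw [neg_div, Complex.exp_neg]
  have e3 : Complex.exp (-(a / 2)) = (Complex.exp (a / 2))⁻¹ := Complex.exp_neg _
  have e4 : Complex.exp (-a) = (Complex.exp (a / 2))⁻¹ * (Complex.exp (a / 2))⁻¹ := by
    rw [Complex.exp_neg, e1, mul_inv]
  rw [e4, e3, e2, e1]
  have he : Complex.exp ((a : ℂ) / 2) ≠ 0 := Complex.exp_ne_zero _
  field_simp
  ring

/-- The Fourier series of `x ↦ cosh (a (x - 1/2))` on `[0, 1)`. -/
lemma hasSum_cos_fourier_cosh {a : ℝ} (ha : 0 < a) {x : ℝ} (hx : x ∈ Set.Ico (0 : ℝ) 1) :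
    HasSum (fun n : ℤ => 2 * a * Real.sinh (a / 2) * (a ^ 2 + 4 * π ^ 2 * (n : ℝ) ^ 2)⁻¹ *
      Real.cos (2 * π * n * x)) (Real.cosh (a * (x - 1 / 2))) := by
  let f : ℝ → ℂ := fun x => (Real.cosh (a * (x - 1 / 2)) : ℂ)
  have hf : Continuous f := by fun_prop
  have hper : f 0 = f (0 + 1) := by
    simp only [f]
    rw [← Real.cosh_neg]
    congr 2
    ring
  let F : C(AddCircle (1 : ℝ), ℂ) :=
    ⟨AddCircle.liftIco 1 0 f, AddCircle.liftIco_continuous hper hf.continuousOn⟩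
  have hcoeff : fourierCoeff F = fun n : ℤ =>
      ((2 * a * Real.sinh (a / 2) * (a ^ 2 + 4 * π ^ 2 * (n : ℝ) ^ 2)⁻¹ : ℝ) : ℂ) := by
    funext n
    rw [← fourierCoeffOn_cosh ha n]
    simp only [F, ContinuousMap.coe_mk, fourierCoeff_liftIco_eq, zero_add, f]
  have hsum : Summable (fourierCoeff F) := by
    rw [hcoeff]
    exact Complex.summable_ofReal.mpr
      ((summable_inv_add_mul_int_sq (by positivity) (by positivity)).mul_left _)
  have h := Complex.hasSum_re (has_pointwise_sum_fourier_series_of_summable hsum x)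
  have hFx : F (x : AddCircle (1 : ℝ)) = f x :=
    AddCircle.liftIco_coe_apply (p := (1 : ℝ)) (a := 0) (f := f) (by simpa using hx)
  rw [hFx, hcoeff] at h
  simp only [f, Complex.ofReal_re] at h
  convert h using 2 with n
  rw [smul_eq_mul, Complex.re_ofReal_mul, fourier_coe_apply]
  congr 1
  rw [← Complex.exp_ofReal_mul_I_re]
  congr 2
  push_cast
  ring

/-- The partial fraction expansion behind the Laplace transform of the eta function. -/
lemma hasSum_cos_div_odd_sq_add {z : ℝ} (hz : 0 < z) :
    HasSum (fun n : ℕ => Real.cos (π * (2 * (n : ℝ) + 1) / 6) /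
      ((2 * (n : ℝ) + 1) ^ 2 + 4 * z ^ 2))
      (π / (8 * z) * Real.sinh (2 * π * z / 3) / Real.cosh (π * z)) := by
  have ha : 0 < 4 * π * z := by positivity
  have h := (hasSum_cos_fourier_cosh ha (x := 1 / 12) (by norm_num)).sub
    (hasSum_cos_fourier_cosh ha (x := 7 / 12) (by norm_num))
  have hinj : Function.Injective fun k : ℤ => 2 * k + 1 := fun i j hij => by
    simpa using hij
  rw [← hinj.hasSum_iff fun n hn => ?_] at h
  · have hs : Real.sinh (π * z) ≠ 0 := (Real.sinh_pos_iff.mpr (by positivity)).ne'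
    have hc : Real.cosh (π * z) ≠ 0 := (Real.cosh_pos _).ne'
    have h2 := h.nat_add_neg_add_one.mul_left
      (π / (8 * z) * (2 * Real.sinh (π * z) * Real.cosh (π * z))⁻¹)
    convert! h2 using 1
    · funext n
      have hsin : Real.sinh (4 * π * z / 2) = 2 * Real.sinh (π * z) * Real.cosh (π * z) := by
        rw [← Real.sinh_two_mul]; congr 1; ring
      have hcos1 : Real.cos (2 * π * (2 * n + 1) * (1 / 12)) =
          Real.cos (π * (2 * n + 1) / 6) := by
        congr 1; ring
      have hcos2 : Real.cos (2 * π * (2 * n + 1) * (7 / 12)) =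
          -Real.cos (π * (2 * n + 1) / 6) := by
        rw [← Real.cos_add_pi, ← Real.cos_add_nat_mul_two_pi (_ + π) n]; congr 1; ring
      have hneg (y : ℝ) : Real.cos (2 * π * (2 * (-(n + 1)) + 1) * y) =
          Real.cos (2 * π * (2 * n + 1) * y) := by
        rw [← Real.cos_neg]; congr 1; ring
      simp only [Function.comp_apply]
      push_cast
      rw [hneg, hneg, hcos1, hcos2, hsin]
      have e : (2 * (-((n : ℝ) + 1)) + 1) ^ 2 = (2 * n + 1) ^ 2 := by ring
      have e' : (4 * π * z) ^ 2 + 4 * π ^ 2 * (2 * (n : ℝ) + 1) ^ 2 =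
        4 * π ^ 2 * ((2 * n + 1) ^ 2 + 4 * z ^ 2) := by ring
      rw [e, e']
      have : (2 * (n : ℝ) + 1) ^ 2 + 4 * z ^ 2 ≠ 0 := by positivity
      field_simp
      ring
    · have e1 : Real.cosh (4 * π * z * (1 / 12 - 1 / 2)) =
          Real.cosh (π * z + 2 * π * z / 3) := by
        rw [← Real.cosh_neg]; congr 1; ring
      have e2 : Real.cosh (4 * π * z * (7 / 12 - 1 / 2)) =
          Real.cosh (π * z - 2 * π * z / 3) := by
        congr 1; ring
      rw [e1, e2, Real.cosh_add, Real.cosh_sub]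
      field_simp
      ring
  · obtain ⟨k, rfl⟩ : Even n := by
      rw [← Int.not_odd_iff_even]
      exact fun ⟨k, hk⟩ => hn ⟨k, hk.symm⟩
    have : Real.cos (2 * π * ((k + k : ℤ) : ℝ) * (7 / 12)) =
        Real.cos (2 * π * ((k + k : ℤ) : ℝ) * (1 / 12)) := by
      rw [← Real.cos_add_int_mul_two_pi (_ * (1 / 12)) k]; congr 1; push_cast; ring
    rw [this, sub_self]

/-- The Laplace transform of Euler's expansion of the Dedekind eta function:
for every `s > 0`,
`∫₀^∞ e^{−sx} (2/√3) ∑_{n≥0} cos(π(2n+1)/6) e^{−π(2n+1)²x/12} dx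
  = √(π/s) sinh(2√(πs/3))/cosh(√(3πs))`. -/
theorem dedekind_eta_laplace_transform (s : ℝ) (hs : 0 < s) :
    ∫ x in Set.Ioi (0 : ℝ),
        Real.exp (-s * x) *
          ((2 / Real.sqrt 3) * ∑' n : ℕ,
            Real.cos (Real.pi * (2 * (n : ℝ) + 1) / 6) *
              Real.exp (-Real.pi * (2 * (n : ℝ) + 1) ^ 2 * x / 12)) =
      Real.sqrt (Real.pi / s) * Real.sinh (2 * Real.sqrt (Real.pi * s / 3)) /
        Real.cosh (Real.sqrt (3 * Real.pi * s)) := by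
  let r : ℕ → ℝ := fun n => s + π / 12 * (2 * (n : ℝ) + 1) ^ 2
  have hr (n : ℕ) : 0 < r n := by positivity
  let G : ℕ → ℝ → ℝ := fun n x =>
    2 / √3 * Real.cos (π * (2 * (n : ℝ) + 1) / 6) * Real.exp (-r n * x)
  have hint (n : ℕ) : IntegrableOn (fun x => Real.exp (-r n * x)) (Set.Ioi 0) :=
    integrableOn_exp_mul_Ioi (neg_neg_of_pos (hr n)) 0
  have hval (n : ℕ) : ∫ x in Set.Ioi (0 : ℝ), Real.exp (-r n * x) = (r n)⁻¹ := by
    rw [integral_exp_mul_Ioi (neg_neg_of_pos (hr n))]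
    simp [neg_div_neg_eq]
  have hrsum : Summable fun n => (r n)⁻¹ := by
    have h := (summable_inv_add_mul_int_sq hs (c := π / 12) (by positivity)).comp_injective
      (i := fun n : ℕ => 2 * (n : ℤ) + 1) fun i j hij => by simpa using hij
    simpa [Function.comp_def, r] using h
  have hnorm : Summable fun n => ∫ x in Set.Ioi (0 : ℝ), ‖G n x‖ := by
    refine Summable.of_nonneg_of_le (fun n => by positivity) (fun n => ?_)
      (hrsum.mul_left (2 / √3))
    simp_rw [G, norm_mul, Real.norm_of_nonneg (Real.exp_pos _).le, integral_const_mul, hval]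
    refine mul_le_mul_of_nonneg_right ?_ (inv_nonneg.mpr (hr n).le)
    rw [Real.norm_of_nonneg (by positivity : 0 ≤ 2 / √3)]
    exact mul_le_of_le_one_right (by positivity) (Real.abs_cos_le_one _)
  have hfun (x : ℝ) : Real.exp (-s * x) * ((2 / √3) * ∑' n : ℕ,
      Real.cos (π * (2 * (n : ℝ) + 1) / 6) * Real.exp (-π * (2 * (n : ℝ) + 1) ^ 2 * x / 12)) =
      ∑' n, G n x := by
    rw [← mul_assoc, ← tsum_mul_left]
    refine tsum_congr fun n => ?_
    have : Real.exp (-r n * x) =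
        Real.exp (-s * x) * Real.exp (-π * (2 * (n : ℝ) + 1) ^ 2 * x / 12) := by
      rw [← Real.exp_add]; congr 1; simp only [r]; ring
    simp only [G, this]
    ring
  simp_rw [hfun]
  rw [← integral_tsum_of_summable_integral_norm (fun n => (hint n).const_mul _) hnorm]
  simp_rw [integral_const_mul, hval]
  obtain ⟨t, ht, rfl⟩ : ∃ t : ℝ, 0 < t ∧ s = π * t ^ 2 / 3 :=
    ⟨√(3 * s / π), by positivity, by rw [Real.sq_sqrt (by positivity)]; field_simp⟩
  have h := (hasSum_cos_div_odd_sq_add ht).mul_left (24 / (√3 * π))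
  have e1 : √(π * (π * t ^ 2 / 3) / 3) = π * t / 3 := by
    rw [show π * (π * t ^ 2 / 3) / 3 = (π * t / 3) ^ 2 by ring, Real.sqrt_sq (by positivity)]
  have e2 : √(3 * π * (π * t ^ 2 / 3)) = π * t := by
    rw [show 3 * π * (π * t ^ 2 / 3) = (π * t) ^ 2 by ring, Real.sqrt_sq (by positivity)]
  have e3 : √(π / (π * t ^ 2 / 3)) = √3 / t := by
    rw [show π / (π * t ^ 2 / 3) = 3 / t ^ 2 by field_simp, Real.sqrt_div (by norm_num),
      Real.sqrt_sq ht.le]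
  have h3 : √3 ^ 2 = 3 := Real.sq_sqrt (by norm_num)
  rw [e1, e2, e3, show 2 * (π * t / 3) = 2 * π * t / 3 by ring]
  convert h.tsum_eq using 1
  · refine tsum_congr fun n => ?_
    have hd : (2 * (n : ℝ) + 1) ^ 2 + 4 * t ^ 2 ≠ 0 := by positivity
    have : r n = π / 12 * ((2 * (n : ℝ) + 1) ^ 2 + 4 * t ^ 2) := by simp only [r]; ring
    rw [this]
    field_simp
    ring
  · field_simp
    rw [h3]
    ring
end

section
/- For every real s > 0, ∫₀^∞ e^{−sx} · ∑_{n=0}^∞ (−1)^n (2n+1) e^{−π(2n+1)² x / 4} dx = 1 / cosh(√(πs)). -/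
open MeasureTheory Real

open Set Filter Topology

lemma tendsto_integral_exp_neg_sq_atTop :
    Tendsto (fun y : ℝ ↦ ∫ t in (0 : ℝ)..y, exp (-t ^ 2)) atTop (𝓝 (√π / 2)) := by
  have hint : IntegrableOn (fun t : ℝ ↦ exp (-t ^ 2)) (Ioi 0) := by
    simpa using (integrable_exp_neg_mul_sq one_pos).integrableOn (s := Ioi 0)
  have hval : ∫ t in Ioi (0 : ℝ), exp (-t ^ 2) = √π / 2 := by
    simpa using integral_gaussian_Ioi 1
  simpa [hval] using intervalIntegral_tendsto_integral_Ioi (0 : ℝ) hint tendsto_id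

lemma tendsto_integral_exp_neg_sq_atBot :
    Tendsto (fun y : ℝ ↦ ∫ t in (0 : ℝ)..y, exp (-t ^ 2)) atBot (𝓝 (-(√π / 2))) := by
  refine ((tendsto_integral_exp_neg_sq_atTop.comp tendsto_neg_atBot_atTop).neg).congr fun y ↦ ?_
  have h := intervalIntegral.integral_comp_neg (fun t : ℝ ↦ exp (-t ^ 2)) (a := 0) (b := y)
  simp only [neg_sq, neg_zero] at h
  rw [Function.comp_apply, h, intervalIntegral.integral_symm]
  simp

lemma hasDerivAt_integral_exp_neg_sq (y : ℝ) :
    HasDerivAt (fun y : ℝ ↦ ∫ t in (0 : ℝ)..y, exp (-t ^ 2)) (exp (-y ^ 2)) y := by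
  have hc : Continuous fun t : ℝ ↦ exp (-t ^ 2) := by fun_prop
  exact hc.integral_hasStrictDerivAt 0 y |>.hasDerivAt

lemma hasDerivAt_mul_sqrt_add_div_sqrt (b c : ℝ) {x : ℝ} (hx : 0 < x) :
    HasDerivAt (fun x : ℝ ↦ c * √x + b / √x) (c / (2 * √x) - b / (2 * (x * √x))) x := by
  have hr : 0 < √x := sqrt_pos.2 hx
  have h := hasDerivAt_sqrt hx.ne'
  have h2 := (h.const_mul c).add ((hasDerivAt_const x b).div h hr.ne')
  refine h2.congr_deriv ?_
  rw [sq_sqrt hx.le]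
  field_simp
  ring

/-- An antiderivative of the Lévy density tilted by an exponential. -/
noncomputable def levyPrimitive (b c x : ℝ) : ℝ :=
  exp (-2 * b * c) * (∫ t in (0 : ℝ)..(c * √x + -b / √x), exp (-t ^ 2)) -
    exp (2 * b * c) * ∫ t in (0 : ℝ)..(c * √x + b / √x), exp (-t ^ 2)

lemma exp_mul_exp_neg_sq (b c : ℝ) {x : ℝ} (hx : 0 < x) :
    exp (2 * b * c) * exp (-(c * √x + b / √x) ^ 2) = exp (-(c ^ 2 * x + b ^ 2 / x)) := by
  have hr : 0 < √x := sqrt_pos.2 hx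
  rw [← exp_add]
  congr 1
  conv_rhs => rw [← sq_sqrt hx.le]
  field_simp
  ring

lemma hasDerivAt_levyPrimitive (b c : ℝ) {x : ℝ} (hx : 0 < x) :
    HasDerivAt (levyPrimitive b c) (b / (x * √x) * exp (-(c ^ 2 * x + b ^ 2 / x))) x := by
  have hr : 0 < √x := sqrt_pos.2 hx
  have h1 := ((hasDerivAt_integral_exp_neg_sq _).comp x
    (hasDerivAt_mul_sqrt_add_div_sqrt (-b) c hx)).const_mul (exp (-2 * b * c))
  have h2 := ((hasDerivAt_integral_exp_neg_sq _).comp x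
    (hasDerivAt_mul_sqrt_add_div_sqrt b c hx)).const_mul (exp (2 * b * c))
  have e1 := exp_mul_exp_neg_sq (-b) c hx
  have e2 := exp_mul_exp_neg_sq b c hx
  rw [show 2 * -b * c = -2 * b * c by ring, neg_sq] at e1
  refine (h1.sub h2).congr_deriv ?_
  rw [← mul_assoc (exp (-2 * b * c)), ← mul_assoc (exp (2 * b * c)), e1, e2]
  field_simp
  ring

lemma tendsto_levyPrimitive_zero {b : ℝ} (hb : 0 < b) (c : ℝ) :
    Tendsto (levyPrimitive b c) (𝓝[>] 0)
      (𝓝 (exp (-2 * b * c) * -(√π / 2) - exp (2 * b * c) * (√π / 2))) := by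
  have hs : Tendsto (fun x : ℝ ↦ √x) (𝓝[>] 0) (𝓝[>] 0) := by
    refine tendsto_nhdsWithin_iff.2 ⟨?_, ?_⟩
    · simpa using (continuous_sqrt.tendsto 0).mono_left nhdsWithin_le_nhds
    · filter_upwards [self_mem_nhdsWithin] with x hx using sqrt_pos.2 hx
  have hi := tendsto_inv_nhdsGT_zero.comp hs
  have hc : Tendsto (fun x : ℝ ↦ c * √x) (𝓝[>] 0) (𝓝 (c * 0)) :=
    (hs.mono_right nhdsWithin_le_nhds).const_mul c
  have h1 : Tendsto (fun x : ℝ ↦ c * √x + b / √x) (𝓝[>] 0) atTop :=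
    hc.add_atTop (hi.const_mul_atTop hb)
  have h2 : Tendsto (fun x : ℝ ↦ c * √x + -b / √x) (𝓝[>] 0) atBot :=
    hc.add_atBot (hi.const_mul_atTop_of_neg (neg_neg_of_pos hb))
  exact ((tendsto_integral_exp_neg_sq_atBot.comp h2).const_mul _).sub
    ((tendsto_integral_exp_neg_sq_atTop.comp h1).const_mul _)

lemma tendsto_levyPrimitive_atTop (b : ℝ) {c : ℝ} (hc : 0 < c) :
    Tendsto (levyPrimitive b c) atTop
      (𝓝 (exp (-2 * b * c) * (√π / 2) - exp (2 * b * c) * (√π / 2))) := by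
  have h (b : ℝ) : Tendsto (fun x : ℝ ↦ c * √x + b / √x) atTop atTop :=
    (tendsto_sqrt_atTop.const_mul_atTop hc).atTop_add (tendsto_sqrt_atTop.const_div_atTop b)
  exact ((tendsto_integral_exp_neg_sq_atTop.comp (h (-b))).const_mul _).sub
    ((tendsto_integral_exp_neg_sq_atTop.comp (h b)).const_mul _)

/-- The Laplace transform of the Lévy density. -/
lemma integrableOn_and_integral_levy {b c : ℝ} (hb : 0 < b) (hc : 0 < c) :
    IntegrableOn (fun x ↦ b / (x * √x) * exp (-(c ^ 2 * x + b ^ 2 / x))) (Ioi 0) ∧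
      ∫ x in Ioi (0 : ℝ), b / (x * √x) * exp (-(c ^ 2 * x + b ^ 2 / x)) =
        √π * exp (-2 * b * c) := by
  set m := exp (-2 * b * c) * -(√π / 2) - exp (2 * b * c) * (√π / 2) with hm
  have heq {x : ℝ} (hx : 0 < x) :
      Function.update (levyPrimitive b c) 0 m =ᶠ[𝓝 x] levyPrimitive b c := by
    filter_upwards [lt_mem_nhds hx] with y hy using Function.update_of_ne hy.ne' ..
  have hcont : ContinuousWithinAt (Function.update (levyPrimitive b c) 0 m) (Ici 0) 0 := by
    rw [continuousWithinAt_update_same, Ici_sdiff_left]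
    exact tendsto_levyPrimitive_zero hb c
  have hderiv : ∀ x ∈ Ioi (0 : ℝ), HasDerivAt (Function.update (levyPrimitive b c) 0 m)
      (b / (x * √x) * exp (-(c ^ 2 * x + b ^ 2 / x))) x := fun x hx ↦
    (hasDerivAt_levyPrimitive b c hx).congr_of_eventuallyEq (heq hx)
  have hnonneg : ∀ x ∈ Ioi (0 : ℝ), 0 ≤ b / (x * √x) * exp (-(c ^ 2 * x + b ^ 2 / x)) := by
    intro x (hx : 0 < x)
    positivity
  have hlim := (tendsto_levyPrimitive_atTop b hc).congr'
      (f₂ := Function.update (levyPrimitive b c) 0 m) <| by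
    filter_upwards [eventually_gt_atTop 0] with y hy
    exact (Function.update_of_ne hy.ne' ..).symm
  refine ⟨integrableOn_Ioi_deriv_of_nonneg hcont hderiv hnonneg hlim, ?_⟩
  rw [integral_Ioi_of_hasDerivAt_of_nonneg hcont hderiv hnonneg hlim, Function.update_self, hm]
  ring

/-- The general term of the transformed theta series times the Laplace kernel is, up to sign,
a multiple of a tilted Lévy density. -/
lemma exp_mul_theta_term_eq {s a x : ℝ} (hs : 0 < s) (ha : a ≠ 0) :
    exp (-s * x) * (4 / (x * √x) * (a * exp (-π * a ^ 2 * (4 / x)))) =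
      2 * (a / |a|) / √π * (2 * √π * |a| / (x * √x) *
        exp (-(√s ^ 2 * x + (2 * √π * |a|) ^ 2 / x))) := by
  have hpi : 0 < √π := sqrt_pos.2 pi_pos
  have ha' : 0 < |a| := abs_pos.2 ha
  have he : exp (-(√s ^ 2 * x + (2 * √π * |a|) ^ 2 / x)) =
      exp (-s * x) * exp (-π * a ^ 2 * (4 / x)) := by
    rw [← exp_add, mul_pow, mul_pow, sq_sqrt hs.le, sq_sqrt pi_pos.le, sq_abs]
    congr 1
    ring
  rw [he]
  field_simp
  ring

lemma integrableOn_theta_term {s a : ℝ} (hs : 0 < s) (ha : a ≠ 0) :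
    IntegrableOn (fun x ↦ exp (-s * x) * (4 / (x * √x) * (a * exp (-π * a ^ 2 * (4 / x)))))
      (Ioi 0) := by
  simp_rw [exp_mul_theta_term_eq hs ha]
  exact (integrableOn_and_integral_levy (by positivity) (sqrt_pos.2 hs)).1.const_mul _

lemma integral_theta_term {s a : ℝ} (hs : 0 < s) (ha : a ≠ 0) :
    ∫ x in Ioi (0 : ℝ), exp (-s * x) * (4 / (x * √x) * (a * exp (-π * a ^ 2 * (4 / x)))) =
      2 * (a / |a|) * exp (-4 * |a| * √(π * s)) := by
  have hpi : 0 < √π := sqrt_pos.2 pi_pos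
  simp_rw [exp_mul_theta_term_eq hs ha]
  rw [integral_const_mul,
    (integrableOn_and_integral_levy (by positivity) (sqrt_pos.2 hs)).2, sqrt_mul pi_pos.le,
    show -2 * (2 * √π * |a|) * √s = -4 * |a| * (√π * √s) by ring]
  field_simp

lemma integral_norm_theta_term {s a : ℝ} (hs : 0 < s) (ha : a ≠ 0) :
    ∫ x in Ioi (0 : ℝ), ‖exp (-s * x) * (4 / (x * √x) * (a * exp (-π * a ^ 2 * (4 / x))))‖ =
      2 * exp (-4 * |a| * √(π * s)) := by
  have ha' : 0 < |a| := abs_pos.2 ha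
  have h := integral_theta_term hs ha'.ne'
  rw [abs_abs, div_self ha'.ne', mul_one] at h
  rw [← h]
  refine setIntegral_congr_fun measurableSet_Ioi fun x (hx : 0 < x) ↦ ?_
  have h4 : 0 < 4 / (x * √x) := by positivity
  simp [abs_of_pos hx, abs_of_nonneg (sqrt_nonneg x)]

lemma tsum_eta_cubed_eq_sinKernel {x : ℝ} (hx : 0 < x) :
    ∑' n : ℕ, (-1 : ℝ) ^ n * (2 * (n : ℝ) + 1) * exp (-π * (2 * (n : ℝ) + 1) ^ 2 * x / 4) =
      HurwitzZeta.sinKernel ((1 / 4 : ℝ) : UnitAddCircle) (x / 4) / 2 := by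
  have h := HurwitzZeta.hasSum_nat_sinKernel (1 / 4) (t := x / 4) (by positivity)
  have hinj : Function.Injective fun k : ℕ ↦ 2 * k + 1 := fun i j hij ↦ by simpa using hij
  rw [← hinj.hasSum_iff] at h
  · rw [← (h.div_const 2).tsum_eq]
    refine tsum_congr fun n ↦ ?_
    have hsin : sin (2 * π * (1 / 4) * ((2 * n + 1 : ℕ) : ℝ)) = (-1) ^ n := by
      rw [← cos_nat_mul_pi n, ← sin_add_pi_div_two]
      congr 1
      push_cast
      ring
    simp only [Function.comp_apply]
    rw [hsin]
    push_cast
    ring_nf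
  · intro n hn
    obtain ⟨k, rfl⟩ : Even n := by
      rw [← Nat.not_odd_iff_even]
      rintro ⟨k, rfl⟩
      exact hn ⟨k, rfl⟩
    have hsin : sin (2 * π * (1 / 4) * ((k + k : ℕ) : ℝ)) = 0 := by
      rw [← sin_nat_mul_pi k]
      congr 1
      push_cast
      ring
    rw [hsin]
    ring

/-- The modular transformation `x ↦ 1 / x` of `η³`, with the transformed series indexed by `ℤ`. -/
lemma tsum_eta_cubed_eq_tsum_int {x : ℝ} (hx : 0 < x) :
    ∑' n : ℕ, (-1 : ℝ) ^ n * (2 * (n : ℝ) + 1) * exp (-π * (2 * (n : ℝ) + 1) ^ 2 * x / 4) =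
      ∑' n : ℤ, 4 / (x * √x) *
        (((n : ℝ) + 1 / 4) * exp (-π * ((n : ℝ) + 1 / 4) ^ 2 * (4 / x))) := by
  have hr : 0 < √x := sqrt_pos.2 hx
  have hpow : (4 / x) ^ (3 / 2 : ℝ) = 8 / (x * √x) := by
    have h4 : √(4 : ℝ) = 2 := by
      rw [show (4 : ℝ) = 2 ^ 2 by norm_num, sqrt_sq zero_le_two]
    rw [show (3 / 2 : ℝ) = 1 + 1 / 2 by norm_num, rpow_add (by positivity), rpow_one,
      ← sqrt_eq_rpow, sqrt_div' _ hx.le, h4]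
    field_simp
    norm_num
  have hodd := HurwitzZeta.hasSum_int_oddKernel (1 / 4) (x := 4 / x) (by positivity)
  rw [tsum_mul_left, hodd.tsum_eq, HurwitzZeta.oddKernel_functional_equation, hpow, one_div_div,
    tsum_eta_cubed_eq_sinKernel hx]
  field_simp
  ring

lemma hasSum_exp_neg_four_mul_add {u : ℝ} (hu : 0 < u) (r : ℝ) :
    HasSum (fun n : ℕ ↦ exp (-(4 * n + r) * u)) (exp (-r * u) * (1 - exp (-4 * u))⁻¹) := by
  have hlt : exp (-4 * u) < 1 := exp_lt_one_iff.2 (by linarith)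
  refine ((hasSum_geometric_of_lt_one (exp_pos _).le hlt).mul_left (exp (-r * u))).congr_fun
    fun n ↦ ?_
  rw [← exp_nat_mul, ← exp_add]
  congr 1
  ring

lemma abs_natCast_add_quarter (n : ℕ) : |((n : ℤ) : ℝ) + 1 / 4| = n + 1 / 4 := by
  rw [Int.cast_natCast, abs_of_pos (by positivity)]

lemma abs_neg_succ_add_quarter (n : ℕ) : |((-(n + 1) : ℤ) : ℝ) + 1 / 4| = n + 3 / 4 := by
  have : (0 : ℝ) ≤ n := n.cast_nonneg
  push_cast
  rw [abs_of_neg (by linarith)]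
  ring

lemma intCast_add_quarter_ne_zero (n : ℤ) : (n : ℝ) + 1 / 4 ≠ 0 := by
  intro h
  have h4 : (4 * n + 1 : ℝ) = 0 := by linarith
  have : 4 * n + 1 = 0 := by exact_mod_cast h4
  omega

lemma summable_exp_neg_abs_add_quarter {u : ℝ} (hu : 0 < u) :
    Summable fun n : ℤ ↦ 2 * exp (-4 * |(n : ℝ) + 1 / 4| * u) := by
  refine Summable.mul_left _ (HasSum.of_nat_of_neg_add_one
    ((hasSum_exp_neg_four_mul_add hu 1).congr_fun fun n ↦ ?_)
    ((hasSum_exp_neg_four_mul_add hu 3).congr_fun fun n ↦ ?_)).summable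
  · rw [abs_natCast_add_quarter]
    ring_nf
  · rw [abs_neg_succ_add_quarter]
    ring_nf

lemma hasSum_sign_mul_exp_neg_abs_add_quarter {u : ℝ} (hu : 0 < u) :
    HasSum (fun n : ℤ ↦ 2 * (((n : ℝ) + 1 / 4) / |(n : ℝ) + 1 / 4|) *
      exp (-4 * |(n : ℝ) + 1 / 4| * u)) (1 / cosh u) := by
  have hlt : exp (-4 * u) < 1 := exp_lt_one_iff.2 (by linarith)
  have hval : 2 * (exp (-1 * u) * (1 - exp (-4 * u))⁻¹) +
      -2 * (exp (-3 * u) * (1 - exp (-4 * u))⁻¹) = 1 / cosh u := by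
    have h3 : exp (-3 * u) = exp (-u) ^ 3 := by rw [← exp_nat_mul]; congr 1; push_cast; ring
    have h4 : exp (-4 * u) = exp (-u) ^ 4 := by rw [← exp_nat_mul]; congr 1; push_cast; ring
    have hinv : exp u = (exp (-u))⁻¹ := by rw [exp_neg, inv_inv]
    have hne : 1 - exp (-u) ^ 4 ≠ 0 := by rw [← h4]; linarith
    have hpos := exp_pos (-u)
    rw [cosh_eq, h3, h4, hinv, neg_one_mul]
    generalize exp (-u) = q at *
    field_simp
    ring
  rw [← hval]
  refine HasSum.of_nat_of_neg_add_one
    (((hasSum_exp_neg_four_mul_add hu 1).mul_left 2).congr_fun fun n ↦ ?_)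
    (((hasSum_exp_neg_four_mul_add hu 3).mul_left (-2)).congr_fun fun n ↦ ?_)
  · have hn : (n : ℝ) + 1 / 4 ≠ 0 := by positivity
    rw [abs_natCast_add_quarter, Int.cast_natCast, div_self hn]
    ring_nf
  · have hn : (n : ℝ) + 3 / 4 ≠ 0 := by positivity
    rw [abs_neg_succ_add_quarter,
      show ((-(n + 1) : ℤ) : ℝ) + 1 / 4 = -((n : ℝ) + 3 / 4) by push_cast; ring,
      neg_div, div_self hn]
    ring_nf

/-- The Laplace transform of the Jacobi triple-product expansion of `η³(ix)`:
for every `s > 0`,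
`∫₀^∞ e^{−sx} ∑_{n≥0} (−1)^n (2n+1) e^{−π(2n+1)²x/4} dx = 1/cosh(√(πs))`. -/
theorem eta_cubed_laplace_transform (s : ℝ) (hs : 0 < s) :
    ∫ x in Set.Ioi (0 : ℝ),
        Real.exp (-s * x) *
          ∑' n : ℕ, (-1 : ℝ) ^ n * (2 * (n : ℝ) + 1) *
            Real.exp (-Real.pi * (2 * (n : ℝ) + 1) ^ 2 * x / 4) =
      1 / Real.cosh (Real.sqrt (Real.pi * s)) := by
  have hu : 0 < √(π * s) := sqrt_pos.2 (by positivity)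
  have hsum := hasSum_integral_of_summable_integral_norm
    (F := fun (n : ℤ) x ↦ exp (-s * x) * (4 / (x * √x) *
      (((n : ℝ) + 1 / 4) * exp (-π * ((n : ℝ) + 1 / 4) ^ 2 * (4 / x)))))
    (μ := volume.restrict (Ioi 0))
    (fun n ↦ integrableOn_theta_term hs (intCast_add_quarter_ne_zero n))
    (by simpa only [integral_norm_theta_term hs (intCast_add_quarter_ne_zero _)] using
      summable_exp_neg_abs_add_quarter hu)
  simp only [integral_theta_term hs (intCast_add_quarter_ne_zero _)] at hsum
  rw [← hsum.unique (hasSum_sign_mul_exp_neg_abs_add_quarter hu)]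
  refine setIntegral_congr_fun measurableSet_Ioi fun x hx ↦ ?_
  simp only [tsum_eta_cubed_eq_tsum_int hx, tsum_mul_left]
end

section
/- For every real z > 0, ∑_{n=0}^∞ cos(π(2n+1)/6) / ((2n+1)² + 4z²) = (π / (8z)) · sinh(2πz/3) / cosh(πz). -/
open Real

/-- The Fourier coefficients of the `π`-antiperiodic extension of `sinh (a (π / 2 - x))`. -/
lemma integral_exp_odd_mul_sinh {a : ℝ} (ha : a ≠ 0) (n : ℤ) :
    ∫ x in (0 : ℝ)..π, Complex.exp (-((2 * n + 1) * Complex.I) * x) *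
        Complex.sinh (a * (π / 2 - x)) =
      2 * a * Complex.cosh (a * π / 2) / ((2 * n + 1) ^ 2 + a ^ 2) := by
  set c : ℂ := (2 * n + 1) * Complex.I with hc
  have hcim : c.re = 0 := by simp [hc]
  have h₁ : -c - a ≠ 0 := fun h ↦ ha (by simpa [hcim] using congrArg Complex.re h)
  have h₂ : -c + a ≠ 0 := fun h ↦ ha (by simpa [hcim] using congrArg Complex.re h)
  have hcπ : Complex.exp (-c * π) = -1 := by
    have : -c * π = -(π * Complex.I) - n * (2 * π * Complex.I) := by rw [hc]; ring
    rw [this, Complex.exp_sub, Complex.exp_int_mul_two_pi_mul_I, Complex.exp_neg,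
      Complex.exp_pi_mul_I]
    norm_num
  have hsplit : ∀ x : ℝ, Complex.exp (-c * x) * Complex.sinh (a * (π / 2 - x)) =
      Complex.exp (a * π / 2) / 2 * Complex.exp ((-c - a) * x) -
        Complex.exp (-(a * π / 2)) / 2 * Complex.exp ((-c + a) * x) := by
    intro x
    rw [Complex.sinh, mul_div_assoc', mul_sub, ← Complex.exp_add, ← Complex.exp_add,
      div_mul_eq_mul_div, div_mul_eq_mul_div, ← Complex.exp_add, ← Complex.exp_add, sub_div]
    ring_nf
  simp_rw [hsplit]
  rw [intervalIntegral.integral_sub (Continuous.intervalIntegrable (by fun_prop) _ _)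
      (Continuous.intervalIntegrable (by fun_prop) _ _),
    intervalIntegral.integral_const_mul, intervalIntegral.integral_const_mul,
    integral_exp_mul_complex h₁, integral_exp_mul_complex h₂]
  have e₁ : Complex.exp ((-c - a) * π) = -Complex.exp (-(a * π / 2)) ^ 2 := by
    rw [show (-c - a) * π = -c * π + (2 : ℕ) * (-(a * π / 2)) by push_cast; ring,
      Complex.exp_add, Complex.exp_nat_mul, hcπ]
    ring
  have e₂ : Complex.exp ((-c + a) * π) = -Complex.exp (a * π / 2) ^ 2 := by
    rw [show (-c + a) * π = -c * π + (2 : ℕ) * (a * π / 2) by push_cast; ring,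
      Complex.exp_add, Complex.exp_nat_mul, hcπ]
    ring
  have e₃ : Complex.exp (a * π / 2) * Complex.exp (-(a * π / 2)) = 1 := by
    rw [← Complex.exp_add]; simp
  have hden : ((2 * n + 1) ^ 2 + a ^ 2 : ℂ) = -(-c - a) * (-c + a) := by
    rw [hc]; linear_combination (2 * n + 1 : ℂ) ^ 2 * Complex.I_sq
  rw [e₁, e₂, hden, Complex.cosh]
  simp only [Complex.ofReal_zero, mul_zero, Complex.exp_zero]
  field_simp
  generalize Complex.exp (a * π / 2) = u at *
  generalize Complex.exp (-(a * π / 2)) = v at *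
  linear_combination (-(-c + a) * v + (-c - a) * u) * e₃

lemma summable_one_div_odd_sq_add_sq (a : ℝ) :
    Summable fun n : ℤ ↦ 1 / ((2 * (n : ℝ) + 1) ^ 2 + a ^ 2) := by
  have h := (Real.summable_one_div_int_add_rpow (1 / 2) 2).mpr one_lt_two
  refine Summable.of_nonneg_of_le (fun n ↦ by positivity) (fun n ↦ ?_) h
  have hn : (n : ℝ) + 1 / 2 ≠ 0 := by
    intro h0
    have : 2 * n + 1 = 0 := by exact_mod_cast (by linarith : 2 * (n : ℝ) + 1 = 0)
    omega
  have hp : 0 < ((n : ℝ) + 1 / 2) ^ 2 := by positivity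
  rw [Real.rpow_two, sq_abs]
  exact one_div_le_one_div_of_le hp (by nlinarith [sq_nonneg a])

lemma hasSum_exp_odd_div {a x : ℝ} (ha : a ≠ 0) (hx : x ∈ Set.Ico 0 π) :
    HasSum (fun n : ℤ ↦ Complex.exp ((2 * n + 1) * x * Complex.I) / ((2 * n + 1) ^ 2 + a ^ 2))
      (π / (2 * a) * Complex.sinh (a * (π / 2 - x)) / Complex.cosh (a * π / 2)) := by
  have hcosh : Complex.cosh (a * π / 2) ≠ 0 := by
    exact_mod_cast (Real.cosh_pos (a * π / 2)).ne'
  have ha' : (a : ℂ) ≠ 0 := by exact_mod_cast ha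
  have hπ : (π : ℂ) ≠ 0 := by exact_mod_cast pi_ne_zero
  have : Fact (0 < π) := ⟨pi_pos⟩
  let f : ℝ → ℂ := fun x ↦ Complex.exp (-(x * Complex.I)) * Complex.sinh (a * (π / 2 - x))
  have hf : f 0 = f π := by
    have : (a * (π / 2 - π) : ℂ) = -(a * (π / 2)) := by ring
    simp [f, this, Complex.exp_neg, Complex.exp_pi_mul_I]
  have hfc : Continuous f := by fun_prop
  let F : C(AddCircle π, ℂ) :=
    ⟨AddCircle.liftIco π 0 f, AddCircle.liftIco_zero_continuous hf hfc.continuousOn⟩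
  have hcoeff : ∀ n : ℤ, fourierCoeff F n =
      2 * a * Complex.cosh (a * π / 2) / π * (1 / ((2 * n + 1) ^ 2 + a ^ 2)) := by
    intro n
    change fourierCoeff (AddCircle.liftIco π 0 f) n = _
    rw [fourierCoeff_liftIco_eq, fourierCoeffOn_eq_integral]
    have hintegrand : ∀ x : ℝ, fourier (-n) (x : AddCircle (0 + π - 0)) • f x =
        Complex.exp (-((2 * n + 1) * Complex.I) * x) * Complex.sinh (a * (π / 2 - x)) := by
      intro x
      rw [fourier_coe_apply, smul_eq_mul, ← mul_assoc, ← Complex.exp_add]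
      congr 2
      push_cast
      field_simp
      ring
    simp_rw [hintegrand, zero_add]
    rw [integral_exp_odd_mul_sinh ha, Complex.real_smul]
    push_cast
    ring
  have hsum : Summable (fourierCoeff F) := by
    rw [funext hcoeff]
    refine Summable.mul_left _ ?_
    exact_mod_cast Complex.hasSum_ofReal.mpr (summable_one_div_odd_sq_add_sq a).hasSum |>.summable
  have h := has_pointwise_sum_fourier_series_of_summable hsum (x : AddCircle π)
  have hFx : F (x : AddCircle π) = f x :=
    AddCircle.liftIco_zero_coe_apply (f := f) hx
  rw [hFx] at h
  convert! h.mul_left (Complex.exp (x * Complex.I) * π / (2 * a * Complex.cosh (a * π / 2)))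
    using 1
  · ext n
    rw [hcoeff, fourier_coe_apply, smul_eq_mul,
      show ((2 * n + 1) * x * Complex.I : ℂ) =
        x * Complex.I + 2 * π * Complex.I * n * x / π by field_simp; ring, Complex.exp_add]
    generalize Complex.cosh (a * π / 2) = C at hcosh
    field_simp
  · have : Complex.exp (x * Complex.I) * Complex.exp (-(x * Complex.I)) = 1 := by
      rw [← Complex.exp_add]; simp
    simp only [f]
    generalize Complex.cosh (a * π / 2) = C at hcosh
    generalize Complex.sinh (a * (π / 2 - x)) = S
    linear_combination (-(π / (2 * a) * S / C)) * this

lemma hasSum_cos_odd_div {a x : ℝ} (ha : a ≠ 0) (hx : x ∈ Set.Ico 0 π) :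
    HasSum (fun n : ℕ ↦ cos ((2 * n + 1) * x) / ((2 * n + 1) ^ 2 + a ^ 2))
      (π / (4 * a) * (sinh (a * (π / 2 - x)) / cosh (a * π / 2))) := by
  rw [← Complex.hasSum_ofReal]
  convert! (hasSum_exp_odd_div ha hx).nat_add_neg_add_one.div_const 2 using 1
  · ext n
    push_cast
    rw [Complex.cos, show (2 * (-(n + 1)) + 1 : ℂ) = -(2 * n + 1) by ring, neg_sq, ← add_div]
    ring_nf
  · push_cast
    ring

/-- For every real `z > 0`,
`∑_{n≥0} cos(π(2n+1)/6)/((2n+1)² + 4z²) = (π/(8z)) sinh(2πz/3)/cosh(πz)`. -/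
theorem cos_over_odd_squares_sum (z : ℝ) (hz : 0 < z) :
    ∑' n : ℕ, Real.cos (Real.pi * (2 * (n : ℝ) + 1) / 6) /
        ((2 * (n : ℝ) + 1) ^ 2 + 4 * z ^ 2) =
      Real.pi / (8 * z) * (Real.sinh (2 * Real.pi * z / 3) / Real.cosh (Real.pi * z)) := by
  have hx : π / 6 ∈ Set.Ico 0 π := ⟨by positivity, by linarith [pi_pos]⟩
  convert! (hasSum_cos_odd_div (mul_ne_zero two_ne_zero hz.ne') hx).tsum_eq using 1
  · congr! 3 with n <;> ring_nf
  · congr! 2 <;> ring_nf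
end

section
/- Let b be real with −1 < b < 1, let 0 < α < π satisfy cos α = −b, and let x be a nonzero real number. Then ∫_{−∞}^∞ e^{itx} / (cosh t + b) dt = (2π / sin α) · sinh((π − α)x) / sinh(πx). -/
open MeasureTheory Real Complex

open Filter Topology Set

theorem one_add_sq_div_two_le_real_cosh (t : ℝ) : 1 + t ^ 2 / 2 ≤ Real.cosh t := by
  have hsinh : (t / 2) ^ 2 ≤ Real.sinh (t / 2) ^ 2 := by
    rw [sq_le_sq]
    rcases le_total 0 (t / 2) with h | h
    · rw [abs_of_nonneg h, abs_of_nonneg (Real.sinh_nonneg_iff.2 h)]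
      exact Real.self_le_sinh_iff.2 h
    · rw [abs_of_nonpos h, abs_of_nonpos (Real.sinh_nonpos_iff.2 h)]
      exact neg_le_neg (Real.sinh_le_self_iff.2 h)
  have hdouble := Real.cosh_two_mul (t / 2)
  have hsq := Real.cosh_sq (t / 2)
  rw [mul_div_cancel₀ t two_ne_zero] at hdouble
  nlinarith

theorem real_cosh_add_pos {c : ℝ} (hc : -1 < c) (t : ℝ) : 0 < Real.cosh t + c := by
  linarith [Real.one_le_cosh t]

theorem neg_one_lt_cos_of_abs_lt_pi {s : ℝ} (hs : |s| < π) : -1 < Real.cos s := by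
  rw [← Real.cos_abs, ← Real.cos_pi]
  exact Real.cos_lt_cos_of_nonneg_of_le_pi (abs_nonneg s) le_rfl hs

theorem integrable_inv_real_cosh_add {c : ℝ} (hc : -1 < c) :
    Integrable fun t : ℝ => (Real.cosh t + c)⁻¹ := by
  set m := min (1 + c) (1 / 2)
  have hm : 0 < m := lt_min (by linarith) (by norm_num)
  refine (integrable_inv_one_add_sq.const_mul m⁻¹).mono' (by fun_prop) (ae_of_all _ fun t => ?_)
  have hpos := real_cosh_add_pos hc t
  rw [Real.norm_of_nonneg (inv_nonneg.2 hpos.le), ← mul_inv]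
  refine inv_anti₀ (by positivity) ?_
  have h1 : m ≤ 1 + c := min_le_left _ _
  have h2 : m ≤ 1 / 2 := min_le_right _ _
  nlinarith [one_add_sq_div_two_le_real_cosh t, sq_nonneg t]

theorem cosh_add_mul_I (t s : ℝ) :
    Complex.cosh (t + s * I) =
      Real.cosh t * Real.cos s + Real.sinh t * Real.sin s * I := by
  rw [Complex.cosh_add, Complex.cosh_mul_I, Complex.sinh_mul_I]
  push_cast
  ring

theorem one_add_cosh_mul_conj (t s : ℝ) :
    (1 + Complex.cosh (t + s * I)) * (1 + Complex.cosh (t + (-s : ℝ) * I)) =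
      (((Real.cosh t + Real.cos s) ^ 2 : ℝ) : ℂ) := by
  have hc : (Complex.cosh t) ^ 2 - Complex.sinh t ^ 2 = 1 := Complex.cosh_sq_sub_sinh_sq t
  have hs : Complex.sin s ^ 2 + Complex.cos s ^ 2 = 1 := Complex.sin_sq_add_cos_sq s
  rw [cosh_add_mul_I, cosh_add_mul_I, Real.cos_neg, Real.sin_neg]
  push_cast
  linear_combination (-Complex.sinh t ^ 2 * Complex.sin s ^ 2) * Complex.I_sq +
    (-Complex.sin s ^ 2) * hc + (Complex.cosh t ^ 2 - 1) * hs

theorem norm_one_add_cosh (t s : ℝ) :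
    ‖1 + Complex.cosh (t + s * I)‖ = Real.cosh t + Real.cos s := by
  have hnonneg : 0 ≤ Real.cosh t + Real.cos s := by
    linarith [Real.one_le_cosh t, Real.neg_one_le_cos s]
  have hc := Real.cosh_sq t
  have hs := Real.sin_sq_add_cos_sq s
  rw [← sq_eq_sq₀ (norm_nonneg _) hnonneg, Complex.sq_norm, Complex.normSq_apply,
    cosh_add_mul_I]
  simp only [add_re, add_im, one_re, one_im, mul_re, mul_im, I_re, I_im, ofReal_re, ofReal_im]
  linear_combination (-Real.sin s ^ 2) * hc + (1 - Real.cosh t ^ 2) * (-hs)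

theorem one_add_cosh_ne_zero {s : ℝ} (hs : |s| < π) (t : ℝ) :
    1 + Complex.cosh (t + s * I) ≠ 0 := by
  rw [← norm_pos_iff, norm_one_add_cosh]
  exact real_cosh_add_pos (neg_one_lt_cos_of_abs_lt_pi hs) t

theorem norm_exp_I_mul_mul (t x : ℝ) : ‖Complex.exp (I * t * x)‖ = 1 := by
  rw [show I * t * x = ((t * x : ℝ) : ℂ) * I by push_cast; ring, Complex.norm_exp_ofReal_mul_I]

theorem integrable_exp_div_one_add_cosh (x : ℝ) {s : ℝ} (hs : |s| < π) :
    Integrable fun t : ℝ => Complex.exp (I * t * x) / (1 + Complex.cosh (t + s * I)) := by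
  refine (integrable_inv_real_cosh_add (neg_one_lt_cos_of_abs_lt_pi hs)).mono' ?_
    (ae_of_all _ fun t => ?_)
  · exact (Continuous.div (by fun_prop)
      (continuous_const.add (Complex.continuous_cosh.comp (by fun_prop)))
      (one_add_cosh_ne_zero hs)).aestronglyMeasurable
  · rw [norm_div, norm_exp_I_mul_mul, norm_one_add_cosh, one_div]

theorem norm_exp_div_one_add_cosh_le {x s y t : ℝ} (hy : |y| ≤ |s|) (ht : t ≠ 0) :
    ‖Complex.exp (I * (t + y * I) * x) / (1 + Complex.cosh (t + y * I))‖ ≤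
      2 * Real.exp (|s| * |x|) / t ^ 2 := by
  rw [norm_div, norm_one_add_cosh, Complex.norm_exp]
  have hre : (I * (t + y * I) * x).re = -(y * x) := by simp
  have hexp : Real.exp (-(y * x)) ≤ Real.exp (|s| * |x|) := by
    refine Real.exp_le_exp.2 ((neg_le_abs _).trans ?_)
    rw [abs_mul]
    gcongr
  have ht2 : 0 < t ^ 2 := by positivity
  have hcosh : t ^ 2 / 2 ≤ Real.cosh t + Real.cos y := by
    linarith [one_add_sq_div_two_le_real_cosh t, Real.neg_one_le_cos y]
  rw [hre]
  calc
    _ ≤ Real.exp (|s| * |x|) / (t ^ 2 / 2) := by gcongr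
    _ = _ := by ring

theorem tendsto_vertical_integral {x s : ℝ} {u : ℝ → ℝ} (hu : ∀ R, u R ^ 2 = R ^ 2) :
    Tendsto (fun R : ℝ => ∫ y : ℝ in (0 : ℝ)..s,
      Complex.exp (I * ((u R : ℝ) + y * I) * x) / (1 + Complex.cosh ((u R : ℝ) + y * I)))
      atTop (𝓝 0) := by
  refine squeeze_zero_norm' (a := fun R : ℝ => 2 * Real.exp (|s| * |x|) / R ^ 2 * |s - 0|) ?_ ?_
  · filter_upwards [eventually_gt_atTop 0] with R hR
    refine intervalIntegral.norm_integral_le_of_norm_le_const fun y hy => ?_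
    rw [← hu R]
    refine norm_exp_div_one_add_cosh_le ?_ ?_
    · have := abs_sub_left_of_mem_uIcc (uIoc_subset_uIcc hy)
      simpa using this
    · intro h
      have := hu R
      rw [h] at this
      nlinarith
  · simpa using (Tendsto.div_atTop (tendsto_const_nhds (x := 2 * Real.exp (|s| * |x|)))
      (tendsto_pow_atTop (n := 2) two_ne_zero)).mul_const |s - 0|

/-- Moving the line of integration from the real axis to `Im z = s` meets no pole. -/
theorem integral_exp_div_one_add_cosh_shift (x : ℝ) {s : ℝ} (hs : |s| < π) :
    ∫ t : ℝ, Complex.exp (I * t * x) / (1 + Complex.cosh (t + s * I)) =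
      Complex.exp (s * x) * ∫ t : ℝ, Complex.exp (I * t * x) / (1 + Complex.cosh t) := by
  set f : ℂ → ℂ := fun z => Complex.exp (I * z * x) / (1 + Complex.cosh z) with hf
  have hrect : ∀ R : ℝ, (∫ t : ℝ in (-R)..R, f t) - (∫ t : ℝ in (-R)..R, f (t + s * I)) +
      I • (∫ y : ℝ in (0 : ℝ)..s, f (R + y * I)) -
      I • (∫ y : ℝ in (0 : ℝ)..s, f ((-R : ℝ) + y * I)) = 0 := by
    intro R
    have hdiff : DifferentiableOn ℂ f (uIcc (-R) R ×ℂ uIcc 0 s) := by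
      intro z hz
      have him : |z.im| < π := by
        have := abs_sub_left_of_mem_uIcc hz.2
        simp only [sub_zero] at this
        exact this.trans_lt hs
      have hne : 1 + Complex.cosh z ≠ 0 := by
        simpa only [Complex.re_add_im] using one_add_cosh_ne_zero him z.re
      refine DifferentiableAt.differentiableWithinAt (DifferentiableAt.div (by fun_prop) ?_ hne)
      exact (Complex.differentiable_cosh z).const_add 1
    have := Complex.integral_boundary_rect_eq_zero_of_differentiableOn f ⟨-R, 0⟩ ⟨R, s⟩
      (by simpa using hdiff)
    simpa using this
  have hbase := integrable_exp_div_one_add_cosh x (s := 0) (by simpa using Real.pi_pos)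
  have htop : (fun t : ℝ => f (t + s * I)) = fun t : ℝ => Complex.exp (-(s * x)) *
      (Complex.exp (I * t * x) / (1 + Complex.cosh (t + s * I))) := by
    funext t
    simp only [hf]
    rw [← mul_div_assoc, ← Complex.exp_add]
    congr 2
    linear_combination (s * x : ℂ) * Complex.I_sq
  have hlim := (((intervalIntegral_tendsto_integral (f := fun t : ℝ => f t)
    (by simpa [hf] using hbase) tendsto_neg_atTop_atBot tendsto_id).sub
    (intervalIntegral_tendsto_integral (f := fun t : ℝ => f (t + s * I))
      (by rw [htop]; exact (integrable_exp_div_one_add_cosh x hs).const_mul _)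
      tendsto_neg_atTop_atBot tendsto_id)).add
    ((tendsto_vertical_integral (x := x) (s := s) (u := fun R => R)
      fun R => rfl).const_smul I)).sub
    ((tendsto_vertical_integral (x := x) (s := s) (u := fun R => -R)
      fun R => neg_sq R).const_smul I)
  have hzero := tendsto_nhds_unique (hlim.congr hrect) tendsto_const_nhds
  rw [htop, integral_const_mul, smul_zero, add_zero, sub_zero, sub_eq_zero] at hzero
  rw [show (∫ t : ℝ, Complex.exp (I * t * x) / (1 + Complex.cosh t)) = ∫ t : ℝ, f t from rfl,
    hzero, ← mul_assoc, ← Complex.exp_add, add_neg_cancel, Complex.exp_zero, one_mul]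

theorem integrable_exp_div_real_cosh_add (x : ℝ) {c : ℝ} (hc : -1 < c) :
    Integrable fun t : ℝ => Complex.exp (I * t * x) / ((Real.cosh t + c : ℝ) : ℂ) := by
  refine (integrable_inv_real_cosh_add hc).mono' ?_ (ae_of_all _ fun t => ?_)
  · exact (Continuous.div (by fun_prop) (by fun_prop)
      fun t => ofReal_ne_zero.2 (real_cosh_add_pos hc t).ne').aestronglyMeasurable
  · rw [norm_div, norm_exp_I_mul_mul, Complex.norm_of_nonneg (real_cosh_add_pos hc t).le, one_div]

theorem hasDerivAt_inv_real_cosh_add_cos {s : ℝ} (hs : |s| < π) (t : ℝ) :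
    HasDerivAt (fun t : ℝ => 2 * I * Real.sin s * ((Real.cosh t + Real.cos s : ℝ) : ℂ)⁻¹)
      (1 / (1 + Complex.cosh (t + s * I)) - 1 / (1 + Complex.cosh (t + (-s : ℝ) * I))) t := by
  have hpos := real_cosh_add_pos (neg_one_lt_cos_of_abs_lt_pi hs) t
  have hderiv := ((((Real.hasDerivAt_cosh t).add_const (Real.cos s)).ofReal_comp).inv
    (ofReal_ne_zero.2 hpos.ne')).const_mul (2 * I * Real.sin s)
  refine hderiv.congr_deriv ?_
  rw [div_sub_div _ _ (one_add_cosh_ne_zero hs t)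
    (one_add_cosh_ne_zero (by rwa [abs_neg]) t), one_add_cosh_mul_conj, cosh_add_mul_I,
    cosh_add_mul_I, Real.cos_neg, Real.sin_neg]
  push_cast
  ring

theorem integral_exp_div_real_cosh_add_cos_eq_mul (x : ℝ) {s : ℝ} (hs : |s| < π) :
    x * Real.sin s * ∫ t : ℝ, Complex.exp (I * t * x) / ((Real.cosh t + Real.cos s : ℝ) : ℂ) =
      Real.sinh (s * x) * ∫ t : ℝ, Complex.exp (I * t * x) / (1 + Complex.cosh t) := by
  have hs' : |-s| < π := by rwa [abs_neg]
  have hcos := neg_one_lt_cos_of_abs_lt_pi hs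
  set Φ := ∫ t : ℝ, Complex.exp (I * t * x) / ((Real.cosh t + Real.cos s : ℝ) : ℂ)
  set A := ∫ t : ℝ, Complex.exp (I * t * x) / (1 + Complex.cosh t)
  have hexp : ∀ t : ℝ, HasDerivAt (fun t : ℝ => Complex.exp (I * t * x))
      (I * x * Complex.exp (I * t * x)) t := fun t => by
    have := (((hasDerivAt_id t).ofReal_comp.const_mul I).mul_const (x : ℂ)).cexp
    exact this.congr_deriv (by simp; ring)
  have hint := integrable_exp_div_one_add_cosh x hs
  have hint' := integrable_exp_div_one_add_cosh x hs'
  have hΦ := integrable_exp_div_real_cosh_add x hcos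
  have hparts := integral_mul_deriv_eq_deriv_mul_of_integrable (fun t _ => hexp t)
    (fun t _ => hasDerivAt_inv_real_cosh_add_cos hs t)
    ((hint.sub hint').congr (ae_of_all _ fun t => by
      simp only [Pi.sub_apply, Pi.mul_apply]; ring))
    ((hΦ.const_mul (-2 * x * Real.sin s)).congr (ae_of_all _ fun t => by
      simp only [Pi.mul_apply]
      linear_combination (-2 * x * Real.sin s * Complex.exp (I * t * x) /
        ((Real.cosh t + Real.cos s : ℝ) : ℂ)) * Complex.I_sq))
    ((hΦ.const_mul (2 * I * Real.sin s)).congr (ae_of_all _ fun t => by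
      simp only [Pi.mul_apply]; ring))
  have hleft : ∫ t : ℝ, Complex.exp (I * t * x) * (1 / (1 + Complex.cosh (t + s * I)) -
      1 / (1 + Complex.cosh (t + (-s : ℝ) * I))) = 2 * Real.sinh (s * x) * A := by
    simp only [mul_sub, mul_one_div]
    rw [integral_sub hint hint', integral_exp_div_one_add_cosh_shift x hs,
      integral_exp_div_one_add_cosh_shift x hs', ofReal_sinh, Complex.sinh]
    push_cast
    rw [neg_mul]
    ring
  have hright : ∫ t : ℝ, I * x * Complex.exp (I * t * x) *
      (2 * I * Real.sin s * ((Real.cosh t + Real.cos s : ℝ) : ℂ)⁻¹) =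
        -2 * x * Real.sin s * Φ := by
    rw [← integral_const_mul]
    congr 1
    funext t
    linear_combination (2 * x * Real.sin s * Complex.exp (I * t * x) /
        ((Real.cosh t + Real.cos s : ℝ) : ℂ)) * Complex.I_sq
  rw [hleft, hright] at hparts
  linear_combination (-1 / 2 : ℂ) * hparts

theorem integral_two_div_one_add_sq : ∫ t : ℝ, ((2 / (1 + t ^ 2) : ℝ) : ℂ) = 2 * π := by
  rw [integral_complex_ofReal]
  simp only [div_eq_mul_inv]
  rw [integral_const_mul, integral_univ_inv_one_add_sq]
  push_cast
  rfl

theorem mul_sin_div_real_cosh_sub_cos_le {ε u : ℝ} (hε : 0 < ε) (hεπ : ε < π) :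
    |ε * Real.sin ε / (Real.cosh (ε * u) - Real.cos ε)| ≤ π ^ 2 / 2 * (1 + u ^ 2)⁻¹ := by
  have hsin := Real.sin_pos_of_pos_of_lt_pi hε hεπ
  have hcosh := one_add_sq_div_two_le_real_cosh (ε * u)
  have hcos := Real.cos_le_one_sub_mul_cos_sq (x := ε) (by rw [abs_of_pos hε]; exact hεπ.le)
  have hpi : 2 / π ^ 2 ≤ 1 / 2 := by
    rw [div_le_div_iff₀ (by positivity) two_pos]
    nlinarith [Real.pi_gt_three]
  have hden : ε ^ 2 * (2 / π ^ 2 * (1 + u ^ 2)) ≤ Real.cosh (ε * u) - Real.cos ε := by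
    nlinarith [mul_le_mul_of_nonneg_right hpi (sq_nonneg (ε * u))]
  have hpos : 0 < ε ^ 2 * (2 / π ^ 2 * (1 + u ^ 2)) := by positivity
  rw [abs_of_nonneg (div_nonneg (by positivity) (hpos.le.trans hden))]
  calc
    _ ≤ ε * ε / (ε ^ 2 * (2 / π ^ 2 * (1 + u ^ 2))) := by
      gcongr
      exact Real.sin_le hε.le
    _ = _ := by field_simp

theorem tendsto_mul_sin_div_real_cosh_sub_cos (u : ℝ) :
    Tendsto (fun ε : ℝ => ε * Real.sin ε / (Real.cosh (ε * u) - Real.cos ε)) (𝓝[>] 0)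
      (𝓝 (2 / (1 + u ^ 2))) := by
  have hmono : 𝓝[>] (0 : ℝ) ≤ 𝓝[≠] 0 := nhdsWithin_mono _ fun _ h => ne_of_gt h
  have slope : ∀ {f : ℝ → ℝ} {d : ℝ}, f 0 = 0 → HasDerivAt f d 0 →
      Tendsto (fun ε => ε⁻¹ * f ε) (𝓝[>] 0) (𝓝 d) := fun h0 h => by
    simpa [h0] using (hasDerivAt_iff_tendsto_slope_zero.1 h).mono_left hmono
  have hsin := slope Real.sin_zero (by simpa using Real.hasDerivAt_sin 0)
  have hsin2 : Tendsto (fun ε => ε⁻¹ * Real.sin (ε / 2)) (𝓝[>] 0) (𝓝 (1 / 2)) :=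
    slope (f := fun ε => Real.sin (ε / 2)) (by simp)
      (by simpa using ((hasDerivAt_id (0 : ℝ)).div_const 2).sin)
  have hsinh : Tendsto (fun ε => ε⁻¹ * Real.sinh (ε * u / 2)) (𝓝[>] 0) (𝓝 (u / 2)) :=
    slope (f := fun ε => Real.sinh (ε * u / 2)) (by simp)
      (by simpa using (((hasDerivAt_id (0 : ℝ)).mul_const u).div_const 2).sinh)
  have hlim := hsin.div (((hsinh.pow 2).add (hsin2.pow 2)).const_mul 2) (by positivity)
  have hval : 1 / (2 * ((u / 2) ^ 2 + (1 / 2) ^ 2)) = 2 / (1 + u ^ 2) := by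
    have : (1 + u ^ 2) ≠ 0 := by positivity
    have : ((u / 2) ^ 2 + (1 / 2) ^ 2) = (1 + u ^ 2) / 4 := by ring
    rw [this]
    field_simp
    norm_num
  rw [hval] at hlim
  refine hlim.congr' ?_
  filter_upwards [self_mem_nhdsWithin] with ε hε
  have hε : ε ≠ 0 := ne_of_gt hε
  have hcosh : Real.cosh (ε * u) = 1 + 2 * Real.sinh (ε * u / 2) ^ 2 := by
    have h1 := Real.cosh_two_mul (ε * u / 2)
    have h2 := Real.cosh_sq (ε * u / 2)
    rw [mul_div_cancel₀ _ two_ne_zero] at h1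
    linarith
  have hcos : Real.cos ε = 1 - 2 * Real.sin (ε / 2) ^ 2 := by
    have h1 := Real.cos_two_mul' (ε / 2)
    have h2 := Real.sin_sq_add_cos_sq (ε / 2)
    rw [mul_div_cancel₀ _ two_ne_zero] at h1
    linarith
  have hden : Real.cosh (ε * u) - Real.cos ε =
      ε ^ 2 * (2 * ((ε⁻¹ * Real.sinh (ε * u / 2)) ^ 2 + (ε⁻¹ * Real.sin (ε / 2)) ^ 2)) := by
    rw [hcosh, hcos]
    field_simp
    ring
  simp only [Pi.div_apply]
  rw [hden, show ε * Real.sin ε = ε ^ 2 * (ε⁻¹ * Real.sin ε) by field_simp,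
    mul_div_mul_left _ _ (pow_ne_zero 2 hε)]

/-- The kernel `sin s / (cosh t + cos s)` concentrates at `t = 0`, with mass `2π`,
as `s = π - ε` tends to `π`. -/
theorem tendsto_sin_mul_integral_exp_div_real_cosh_sub_cos (x : ℝ) :
    Tendsto (fun ε : ℝ => Real.sin ε *
      ∫ t : ℝ, Complex.exp (I * t * x) / ((Real.cosh t - Real.cos ε : ℝ) : ℂ)) (𝓝[>] 0)
      (𝓝 (2 * π)) := by
  have hscale : ∀ᶠ ε : ℝ in 𝓝[>] 0, ∫ u : ℝ, Complex.exp (I * (ε * u : ℝ) * x) *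
      ((ε * Real.sin ε / (Real.cosh (ε * u) - Real.cos ε) : ℝ) : ℂ) =
      Real.sin ε * ∫ t : ℝ, Complex.exp (I * t * x) / ((Real.cosh t - Real.cos ε : ℝ) : ℂ) := by
    filter_upwards [self_mem_nhdsWithin] with ε hε
    have hε : 0 < ε := hε
    have h := Measure.integral_comp_mul_left (fun t : ℝ =>
      Complex.exp (I * t * x) / ((Real.cosh t - Real.cos ε : ℝ) : ℂ)) ε
    rw [abs_of_pos (inv_pos.2 hε), eq_inv_smul_iff₀ hε.ne', Complex.real_smul] at h
    rw [← h, ← integral_const_mul, ← integral_const_mul]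
    congr 1
    funext u
    push_cast
    ring
  refine Tendsto.congr' hscale ?_
  rw [← integral_two_div_one_add_sq]
  refine tendsto_integral_filter_of_dominated_convergence
    (fun u => π ^ 2 / 2 * (1 + u ^ 2)⁻¹) (Eventually.of_forall fun ε => ?_) ?_
    (integrable_inv_one_add_sq.const_mul _) (ae_of_all _ fun u => ?_)
  · exact Measurable.aestronglyMeasurable (by fun_prop)
  · filter_upwards [Ioo_mem_nhdsGT Real.pi_pos] with ε hε
    refine ae_of_all _ fun u => ?_
    rw [norm_mul, norm_exp_I_mul_mul, one_mul, Complex.norm_real, Real.norm_eq_abs]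
    exact mul_sin_div_real_cosh_sub_cos_le hε.1 hε.2
  · have hexp : Tendsto (fun ε : ℝ => Complex.exp (I * (ε * u : ℝ) * x)) (𝓝[>] 0) (𝓝 1) := by
      have : Continuous fun ε : ℝ => Complex.exp (I * (ε * u : ℝ) * x) := by fun_prop
      simpa using (this.tendsto 0).mono_left nhdsWithin_le_nhds
    simpa using hexp.mul
      ((continuous_ofReal.tendsto _).comp (tendsto_mul_sin_div_real_cosh_sub_cos u))

theorem sinh_mul_integral_exp_div_one_add_cosh (x : ℝ) :
    Real.sinh (π * x) * ∫ t : ℝ, Complex.exp (I * t * x) / (1 + Complex.cosh t) = x * (2 * π) := by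
  have hleft : Tendsto (fun ε : ℝ => (Real.sinh ((π - ε) * x) : ℂ) *
      ∫ t : ℝ, Complex.exp (I * t * x) / (1 + Complex.cosh t)) (𝓝[>] 0)
      (𝓝 (Real.sinh (π * x) * ∫ t : ℝ, Complex.exp (I * t * x) / (1 + Complex.cosh t))) := by
    refine Tendsto.mul_const _ ?_
    have : Continuous fun ε : ℝ => (Real.sinh ((π - ε) * x) : ℂ) := by fun_prop
    simpa only [sub_zero] using (this.tendsto 0).mono_left nhdsWithin_le_nhds
  refine tendsto_nhds_unique hleft (Tendsto.congr' ?_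
    ((tendsto_sin_mul_integral_exp_div_real_cosh_sub_cos x).const_mul (x : ℂ)))
  filter_upwards [Ioo_mem_nhdsGT Real.pi_pos] with ε hε
  have h := integral_exp_div_real_cosh_add_cos_eq_mul x (s := π - ε)
    (by rw [abs_of_pos (sub_pos.2 hε.2)]; linarith [hε.1])
  rw [Real.cos_pi_sub, Real.sin_pi_sub] at h
  rw [← h, mul_assoc]
  simp only [sub_eq_add_neg]

/-- For `−1 < b < 1`, `0 < α < π` with `cos α = −b`, and nonzero real `x`,
`∫_{−∞}^∞ e^{itx}/(cosh t + b) dt = (2π/sin α) sinh((π − α)x)/sinh(πx)`. -/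
theorem fourier_reciprocal_cosh_plus_b (b α x : ℝ) (hb₁ : -1 < b) (hb₂ : b < 1)
    (hα₁ : 0 < α) (hα₂ : α < Real.pi) (hcos : Real.cos α = -b) (hx : x ≠ 0) :
    ∫ t : ℝ, Complex.exp (Complex.I * t * x) / ((Real.cosh t + b : ℝ) : ℂ) =
      ((2 * Real.pi / Real.sin α) * (Real.sinh ((Real.pi - α) * x) / Real.sinh (Real.pi * x)) : ℝ) := by
  have hsin := Real.sin_pos_of_pos_of_lt_pi hα₁ hα₂
  have hsinh : Real.sinh (π * x) ≠ 0 :=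
    Real.sinh_ne_zero.2 (mul_ne_zero Real.pi_ne_zero hx)
  have h := integral_exp_div_real_cosh_add_cos_eq_mul x (s := π - α)
    (by rw [abs_of_pos (sub_pos.2 hα₂)]; linarith)
  have hA := sinh_mul_integral_exp_div_one_add_cosh x
  rw [Real.cos_pi_sub, Real.sin_pi_sub, hcos, neg_neg] at h
  have hx' : (x : ℂ) ≠ 0 := ofReal_ne_zero.2 hx
  have hsin' : (Real.sin α : ℂ) ≠ 0 := ofReal_ne_zero.2 hsin.ne'
  have hsinh' : (Real.sinh (π * x) : ℂ) ≠ 0 := ofReal_ne_zero.2 hsinh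
  rw [ofReal_mul, ofReal_div, ofReal_div, ofReal_mul, ofReal_ofNat, div_mul_div_comm,
    eq_div_iff (mul_ne_zero hsin' hsinh')]
  refine mul_left_cancel₀ hx' ?_
  linear_combination (Real.sinh (π * x) : ℂ) * h + (Real.sinh ((π - α) * x) : ℂ) * hA
end

section
/- Let b be real with b > 1, let α > 0 satisfy cosh α = b, and let x be a nonzero real number. Then ∫_{−∞}^∞ e^{itx} / (cosh t + b) dt = (2π / sinh α) · sin(αx) / sinh(πx). -/
open MeasureTheory Real Complex

theorem integrable_sigmoid_mul_one_sub :
    Integrable fun t : ℝ => Real.sigmoid t * (1 - Real.sigmoid t) := by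
  have h := integrableOn_image_iff_integrableOn_abs_deriv_smul MeasurableSet.univ
    (fun t _ => (Real.hasDerivAt_sigmoid t).hasDerivWithinAt)
    Real.sigmoid_injective.injOn (fun _ => (1 : ℝ))
  rw [Set.image_univ, Real.range_sigmoid, integrableOn_univ] at h
  refine (h.1 (by simp)).congr (ae_of_all _ fun t => ?_)
  have := Real.sigmoid_pos t
  have := Real.sigmoid_lt_one t
  simp only [smul_eq_mul, mul_one]
  exact abs_of_nonneg (mul_nonneg (by linarith) (by linarith))

theorem norm_exp_I_mul_ofReal_mul_ofReal (t x : ℝ) :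
    ‖Complex.exp (Complex.I * t * x)‖ = 1 := by
  rw [mul_assoc, ← Complex.ofReal_mul, Complex.norm_exp_I_mul_ofReal]

theorem integrable_exp_mul_ofReal {f : ℝ → ℝ} (hf : Integrable f) (x : ℝ) :
    Integrable fun t : ℝ => (f t : ℂ) * Complex.exp (Complex.I * t * x) :=
  hf.ofReal.mul_bdd (c := 1) (by fun_prop)
    (ae_of_all _ fun t => (norm_exp_I_mul_ofReal_mul_ofReal t x).le)

theorem sigmoid_cpow_mul_one_sub_sigmoid_cpow (t : ℝ) (z : ℂ) :
    (Real.sigmoid t : ℂ) ^ z * (1 - (Real.sigmoid t : ℂ)) ^ (-z) = Complex.exp (t * z) := by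
  have h0 := Real.sigmoid_pos t
  have h1 : 0 < 1 - Real.sigmoid t := sub_pos.2 (Real.sigmoid_lt_one t)
  have hlog : Real.log (1 - Real.sigmoid t) = Real.log (Real.sigmoid t) - t := by
    rw [← Real.sigmoid_neg, ← Real.sigmoid_mul_rexp_neg,
      Real.log_mul h0.ne' (Real.exp_pos _).ne', Real.log_exp, sub_eq_add_neg]
  rw [← Complex.ofReal_one, ← Complex.ofReal_sub,
    Complex.cpow_def_of_ne_zero (Complex.ofReal_ne_zero.2 h0.ne'),
    Complex.cpow_def_of_ne_zero (Complex.ofReal_ne_zero.2 h1.ne'), ← Complex.exp_add,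
    ← Complex.ofReal_log h0.le, ← Complex.ofReal_log h1.le, hlog]
  congr 1
  push_cast
  ring

theorem integral_deriv_sigmoid_mul_exp_eq_betaIntegral (x : ℝ) :
    ∫ t : ℝ, ((Real.sigmoid t * (1 - Real.sigmoid t) : ℝ) : ℂ) *
      Complex.exp (Complex.I * t * x) =
      Complex.betaIntegral (1 + Complex.I * x) (1 - Complex.I * x) := by
  have h := integral_image_eq_integral_abs_deriv_smul MeasurableSet.univ
    (fun t _ => (Real.hasDerivAt_sigmoid t).hasDerivWithinAt) Real.sigmoid_injective.injOn
    (fun u : ℝ => (u : ℂ) ^ (Complex.I * x) * (1 - (u : ℂ)) ^ (-(Complex.I * x)))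
  rw [Set.image_univ, Real.range_sigmoid, setIntegral_univ] at h
  rw [Complex.betaIntegral, intervalIntegral.integral_of_le zero_le_one,
    integral_Ioc_eq_integral_Ioo]
  have e1 : 1 + Complex.I * x - 1 = Complex.I * x := by ring
  have e2 : 1 - Complex.I * x - 1 = -(Complex.I * x) := by ring
  rw [e1, e2, h]
  congr 1 with t
  have := Real.sigmoid_pos t
  have := Real.sigmoid_lt_one t
  rw [sigmoid_cpow_mul_one_sub_sigmoid_cpow,
    abs_of_nonneg (mul_nonneg (by linarith) (by linarith)), Complex.real_smul]
  ring_nf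

theorem integral_deriv_sigmoid_mul_exp {x : ℝ} (hx : x ≠ 0) :
    ∫ t : ℝ, ((Real.sigmoid t * (1 - Real.sigmoid t) : ℝ) : ℂ) *
      Complex.exp (Complex.I * t * x) =
      ((Real.pi * x / Real.sinh (Real.pi * x) : ℝ) : ℂ) := by
  have hIx : Complex.I * x ≠ 0 := by simp [hx]
  have hbeta := Complex.Gamma_mul_Gamma_eq_betaIntegral
    (s := 1 + Complex.I * x) (t := 1 - Complex.I * x) (by simp) (by simp)
  have hsum : 1 + Complex.I * x + (1 - Complex.I * x) = 2 := by ring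
  have hsin : Complex.sin (Real.pi * (Complex.I * x)) =
      Complex.sinh (Real.pi * x) * Complex.I := by
    rw [← Complex.sin_mul_I]; ring_nf
  rw [hsum, show Complex.Gamma 2 = 1 by simp, one_mul,
    add_comm 1 (Complex.I * (x : ℂ)), Complex.Gamma_add_one _ hIx, mul_assoc, Complex.Gamma_mul_Gamma_one_sub,
    hsin] at hbeta
  rw [integral_deriv_sigmoid_mul_exp_eq_betaIntegral, add_comm, ← hbeta]
  have hs : Complex.sinh (Real.pi * x) ≠ 0 := by
    rw [← Complex.ofReal_mul, ← Complex.ofReal_sinh, Complex.ofReal_ne_zero]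
    exact Real.sinh_ne_zero.2 (mul_ne_zero Real.pi_ne_zero hx)
  push_cast
  field_simp

theorem integral_comp_add_mul_exp (f : ℝ → ℂ) (c x : ℝ) :
    ∫ t : ℝ, f (t + c) * Complex.exp (Complex.I * t * x) =
      Complex.exp (-(Complex.I * c * x)) * ∫ t : ℝ, f t * Complex.exp (Complex.I * t * x) := by
  rw [← integral_add_right_eq_self (fun t : ℝ => f t * Complex.exp (Complex.I * t * x)) c, ← integral_const_mul]
  congr 1 with t
  rw [mul_left_comm, ← Complex.exp_add]
  push_cast
  ring_nf

theorem sigmoid_add_sub_sigmoid_sub (t a : ℝ) :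
    Real.sigmoid (t + a) - Real.sigmoid (t - a) =
      Real.sinh a / (Real.cosh t + Real.cosh a) := by
  have hc : Real.cosh t + Real.cosh a ≠ 0 := (add_pos (Real.cosh_pos _) (Real.cosh_pos _)).ne'
  have h1 : 1 + Real.exp (-(t + a)) ≠ 0 := by positivity
  have h2 : 1 + Real.exp (-(t - a)) ≠ 0 := by positivity
  rw [Real.sigmoid_def, Real.sigmoid_def, eq_div_iff hc, inv_sub_inv h1 h2, div_mul_eq_mul_div,
    div_eq_iff (mul_ne_zero h1 h2), Real.sinh_eq, Real.cosh_eq, Real.cosh_eq]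
  simp only [neg_add, sub_eq_add_neg, Real.exp_add, neg_neg, Real.exp_neg]
  have := Real.exp_ne_zero t
  have := Real.exp_ne_zero a
  field_simp
  ring

theorem sigmoid_mul_one_sub_eq (t : ℝ) :
    Real.sigmoid t * (1 - Real.sigmoid t) = 1 / (2 * (Real.cosh t + 1)) := by
  have hc : 2 * (Real.cosh t + 1) ≠ 0 := by have := Real.cosh_pos t; positivity
  have h1 : 1 + Real.exp (-t) ≠ 0 := by positivity
  rw [eq_div_iff hc, Real.sigmoid_def, Real.cosh_eq]
  have := Real.exp_ne_zero t
  rw [Real.exp_neg] at *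
  field_simp
  ring

theorem integrable_sigmoid_add_sub_sigmoid_sub {a : ℝ} (ha : 0 ≤ a) :
    Integrable fun t : ℝ => Real.sigmoid (t + a) - Real.sigmoid (t - a) := by
  refine (integrable_sigmoid_mul_one_sub.const_mul (2 * Real.sinh a)).mono'
    (by have := continuous_sigmoid; fun_prop) (ae_of_all _ fun t => ?_)
  have hs := Real.sinh_nonneg_iff.2 ha
  have ht := Real.cosh_pos t
  have hc := Real.one_le_cosh a
  rw [sigmoid_add_sub_sigmoid_sub, Real.norm_of_nonneg (by positivity), sigmoid_mul_one_sub_eq,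
    show 2 * Real.sinh a * (1 / (2 * (Real.cosh t + 1))) = Real.sinh a / (Real.cosh t + 1) by
      field_simp]
  gcongr

theorem integral_sigmoid_add_sub_sigmoid_sub_mul_exp {a x : ℝ} (ha : 0 ≤ a) (hx : x ≠ 0) :
    ∫ t : ℝ, ((Real.sigmoid (t + a) - Real.sigmoid (t - a) : ℝ) : ℂ) *
      Complex.exp (Complex.I * t * x) =
      ((2 * Real.pi * Real.sin (a * x) / Real.sinh (Real.pi * x) : ℝ) : ℂ) := by
  let k : ℝ → ℝ := fun t => Real.sigmoid t * (1 - Real.sigmoid t)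
  have hk (c : ℝ) : Integrable fun t => k (t + c) :=
    integrable_sigmoid_mul_one_sub.comp_add_right c
  have hk' (c : ℝ) := integrable_exp_mul_ofReal (hk c) x
  have hd := integrable_exp_mul_ofReal (integrable_sigmoid_add_sub_sigmoid_sub ha) x
  have hu (t : ℝ) : HasDerivAt
      (fun t : ℝ => ((Real.sigmoid (t + a) - Real.sigmoid (t - a) : ℝ) : ℂ))
      ((k (t + a) - k (t + -a) : ℝ) : ℂ) t :=
    (((Real.hasDerivAt_sigmoid (t + a)).comp_add_const t a).sub
      ((Real.hasDerivAt_sigmoid (t - a)).comp_sub_const t a)).ofReal_comp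
  have hv (t : ℝ) : HasDerivAt (fun t : ℝ => Complex.exp (Complex.I * t * x))
      (Complex.exp (Complex.I * t * x) * (Complex.I * x)) t := by
    have h := (((Complex.ofRealCLM.hasDerivAt (x := t)).const_mul Complex.I).mul_const
      (x : ℂ)).cexp
    simpa using h
  have hparts := integral_mul_deriv_eq_deriv_mul_of_integrable
    (fun t _ => hu t) (fun t _ => hv t)
    ((hd.mul_const (Complex.I * x)).congr (ae_of_all _ fun t => by simp [mul_assoc]))
    (integrable_exp_mul_ofReal ((hk a).sub (hk (-a))) x) hd
  have hright : ∫ t : ℝ, ((k (t + a) - k (t + -a) : ℝ) : ℂ) * Complex.exp (Complex.I * t * x) =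
      (Complex.exp (-(Complex.I * a * x)) - Complex.exp (Complex.I * a * x)) *
        ((Real.pi * x / Real.sinh (Real.pi * x) : ℝ) : ℂ) := by
    simp_rw [Complex.ofReal_sub, sub_mul]
    rw [integral_sub (hk' a) (hk' (-a)), integral_comp_add_mul_exp (fun t => (k t : ℂ)),
      integral_comp_add_mul_exp (fun t => (k t : ℂ)), integral_deriv_sigmoid_mul_exp hx]
    simp
  simp_rw [← mul_assoc] at hparts
  have hx' : (x : ℂ) ≠ 0 := Complex.ofReal_ne_zero.2 hx
  have hexp : Complex.exp (-(Complex.I * a * x)) - Complex.exp (Complex.I * a * x) =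
      -(2 * Complex.I * Complex.sin (a * x)) := by
    rw [Complex.sin, show Complex.I * a * x = a * x * Complex.I by ring, neg_mul]
    linear_combination
      (Complex.exp (-(a * x * Complex.I)) - Complex.exp (a * x * Complex.I)) * Complex.I_sq
  rw [integral_mul_const, integral_mul_const, hright, hexp] at hparts
  refine mul_right_cancel₀ hx' (mul_right_cancel₀ Complex.I_ne_zero ?_)
  push_cast at hparts ⊢
  linear_combination hparts

/-- For `b > 1`, `α > 0` with `cosh α = b`, and nonzero real `x`,
`∫_{−∞}^∞ e^{itx}/(cosh t + b) dt = (2π/sinh α) sin(αx)/sinh(πx)`. -/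
theorem fourier_reciprocal_cosh_plus_b_large (b α x : ℝ) (hb : 1 < b)
    (hα : 0 < α) (hcosh : Real.cosh α = b) (hx : x ≠ 0) :
    ∫ t : ℝ, Complex.exp (Complex.I * t * x) / ((Real.cosh t + b : ℝ) : ℂ) =
      ((2 * Real.pi / Real.sinh α) * (Real.sin (α * x) / Real.sinh (Real.pi * x)) : ℝ) := by
  subst hcosh
  have hs : (Real.sinh α : ℂ) ≠ 0 := Complex.ofReal_ne_zero.2 (Real.sinh_pos_iff.2 hα).ne'
  have h := integral_sigmoid_add_sub_sigmoid_sub_mul_exp hα.le hx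
  refine mul_left_cancel₀ hs ?_
  rw [← integral_const_mul]
  calc _ = _ := by
        congr 1 with t
        rw [sigmoid_add_sub_sigmoid_sub, Complex.ofReal_div]
        ring
    _ = _ := h
    _ = _ := by
        rw [Complex.ofReal_mul, Complex.ofReal_div _ (Real.sinh α), ← mul_assoc,
          mul_div_cancel₀ _ hs]
        push_cast
        ring
end

section
/- For every nonzero real x, ∫_{−∞}^∞ e^{itx} / cosh²(t) dt = 2π x cosh(πx/2) / sinh(πx). -/
open MeasureTheory Real Complex

/-- The Beta integral in logistic coordinates. -/
theorem betaIntegral_eq_integral_sigmoid (u v : ℂ) :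
    betaIntegral u v = ∫ t : ℝ, (sigmoid t : ℂ) ^ u * (sigmoid (-t) : ℂ) ^ v := by
  have key := integral_image_eq_integral_abs_deriv_smul (s := Set.univ) MeasurableSet.univ
    (fun t _ => (hasDerivAt_sigmoid t).hasDerivWithinAt) sigmoid_injective.injOn
    (fun x : ℝ => (x : ℂ) ^ (u - 1) * (1 - (x : ℂ)) ^ (v - 1))
  rw [Set.image_univ, range_sigmoid, setIntegral_univ] at key
  rw [betaIntegral, intervalIntegral.integral_of_le zero_le_one, integral_Ioc_eq_integral_Ioo, key]
  congr 1 with t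
  have h₁ : (sigmoid t : ℂ) ≠ 0 := ofReal_ne_zero.2 (sigmoid_pos t).ne'
  have h₂ : (1 - sigmoid t : ℂ) ≠ 0 := by
    rw [← ofReal_one, ← ofReal_sub, ← sigmoid_neg]
    exact ofReal_ne_zero.2 (sigmoid_pos (-t)).ne'
  rw [← sigmoid_neg, abs_of_pos (mul_pos (sigmoid_pos t) (sigmoid_pos (-t))), sigmoid_neg,
    real_smul, cpow_sub _ _ h₁, cpow_sub _ _ h₂]
  push_cast
  simp only [cpow_one]
  field_simp

theorem sigmoid_eq_exp_mul_sigmoid_neg (t : ℝ) :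
    sigmoid t = Real.exp t * sigmoid (-t) := by
  rw [← sigmoid_mul_rexp_neg, mul_left_comm, ← Real.exp_add, add_neg_cancel, Real.exp_zero, mul_one]

theorem sigmoid_cpow_mul_sigmoid_neg_cpow (t : ℝ) (a : ℂ) :
    (sigmoid t : ℂ) ^ (1 + a) * (sigmoid (-t) : ℂ) ^ (1 - a) =
      Complex.exp (t * a) * (sigmoid t * sigmoid (-t) : ℝ) := by
  have h₁ : (sigmoid t : ℂ) ≠ 0 := ofReal_ne_zero.2 (sigmoid_pos t).ne'
  have h₂ : (sigmoid (-t) : ℂ) ≠ 0 := ofReal_ne_zero.2 (sigmoid_pos (-t)).ne'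
  have h₃ : (sigmoid t : ℂ) ^ a = Complex.exp (t * a) * (sigmoid (-t) : ℂ) ^ a := by
    rw [sigmoid_eq_exp_mul_sigmoid_neg t, ofReal_mul,
      mul_cpow_ofReal_nonneg (Real.exp_pos t).le (sigmoid_pos (-t)).le,
      cpow_def_of_ne_zero (ofReal_ne_zero.2 (Real.exp_pos t).ne'), ← ofReal_log (Real.exp_pos t).le,
      Real.log_exp]
  have h₄ : (sigmoid (-t) : ℂ) ^ a ≠ 0 := by simp [cpow_eq_zero_iff, h₂]
  rw [cpow_add _ _ h₁, cpow_sub _ _ h₂, h₃, cpow_one, cpow_one]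
  push_cast
  field_simp

theorem sigmoid_two_mul_mul_sigmoid_neg (t : ℝ) :
    sigmoid (2 * t) * sigmoid (-(2 * t)) = (4 * Real.cosh t ^ 2)⁻¹ := by
  rw [sigmoid_def, sigmoid_def, neg_neg, Real.cosh_eq, ← mul_inv, two_mul, neg_add, Real.exp_add,
    Real.exp_add, Real.exp_neg]
  congr 1
  field_simp
  ring

theorem betaIntegral_one_add_one_sub {a : ℂ} (h₀ : a ≠ 0) (h₁ : -1 < a.re) (h₂ : a.re < 1) :
    betaIntegral (1 + a) (1 - a) = π * a / Complex.sin (π * a) := by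
  have h := Complex.Gamma_mul_Gamma_eq_betaIntegral (s := 1 + a) (t := 1 - a)
    (by simp; linarith) (by simp; linarith)
  have hΓ : Complex.Gamma (1 + a + (1 - a)) = 1 := by
    rw [show 1 + a + (1 - a) = ((1 : ℕ) : ℂ) + 1 by push_cast; ring, Complex.Gamma_nat_eq_factorial]
    simp
  rw [hΓ, one_mul] at h
  rw [← h, add_comm, Complex.Gamma_add_one _ h₀, mul_assoc, Complex.Gamma_mul_Gamma_one_sub]
  ring

/-- For every nonzero real `x`,
`∫_{−∞}^∞ e^{itx}/cosh²(t) dt = 2πx cosh(πx/2)/sinh(πx)`. -/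
theorem fourier_reciprocal_cosh_sq (x : ℝ) (hx : x ≠ 0) :
    ∫ t : ℝ, Complex.exp (Complex.I * t * x) / ((Real.cosh t ^ 2 : ℝ) : ℂ) =
      ((2 * Real.pi * x * Real.cosh (Real.pi * x / 2) / Real.sinh (Real.pi * x)) : ℝ) := by
  set a : ℂ := x / 2 * I with ha
  have ha₀ : a ≠ 0 := by simp [ha, hx]
  have hre : a.re = 0 := by simp [ha]
  have hint : ∫ t : ℝ, Complex.exp (Complex.I * t * x) / ((Real.cosh t ^ 2 : ℝ) : ℂ) =
      2 * betaIntegral (1 + a) (1 - a) := by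
    have hscale := Measure.integral_comp_mul_left
      (fun t : ℝ => (sigmoid t : ℂ) ^ (1 + a) * (sigmoid (-t) : ℂ) ^ (1 - a)) 2
    rw [← betaIntegral_eq_integral_sigmoid, abs_of_pos (by norm_num), real_smul] at hscale
    have hfour : 2 * betaIntegral (1 + a) (1 - a) =
        4 * (((2⁻¹ : ℝ) : ℂ) * betaIntegral (1 + a) (1 - a)) := by
      push_cast
      ring
    rw [hfour, ← hscale, ← integral_const_mul]
    congr 1 with t
    rw [sigmoid_cpow_mul_sigmoid_neg_cpow, sigmoid_two_mul_mul_sigmoid_neg,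
      show ((2 * t : ℝ) : ℂ) * a = I * t * x by rw [ha]; push_cast; ring]
    push_cast
    field_simp
  have hsinh : Real.sinh (π * x / 2) ≠ 0 := by
    rw [Ne, Real.sinh_eq_zero]
    positivity
  have hcosh : Real.cosh (π * x / 2) ≠ 0 := (Real.cosh_pos _).ne'
  have hdouble : 2 * π * x * Real.cosh (π * x / 2) / Real.sinh (π * x) =
      π * x / Real.sinh (π * x / 2) := by
    rw [show π * x = 2 * (π * x / 2) by ring, Real.sinh_two_mul]
    field_simp
  have hsin : Complex.sin (π * a) = Real.sinh (π * x / 2) * I := by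
    rw [show (π : ℂ) * a = ((π * x / 2 : ℝ) : ℂ) * I by rw [ha]; push_cast; ring,
      Complex.sin_mul_I, ofReal_sinh]
  have hsinh' := ofReal_ne_zero.2 hsinh
  rw [hint, betaIntegral_one_add_one_sub ha₀ (by rw [hre]; norm_num) (by rw [hre]; norm_num),
    hdouble, hsin, ha, ofReal_div, ofReal_mul]
  field_simp
end
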